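/- arXiv:2206.04172 — 13 statements merged into one kernel-verified Lean document; each statement's English description precedes it below -/
import Mathlib

section
/- Let f : ℝ → ℝ be four times continuously differentiable on a neighborhood of a point x̄ with f'(x̄) = 0, f''(x̄) > 0, f'''(x̄) ≠ 0, and 3·f'''(x̄)² − f''(x̄)·f⁽⁴⁾(x̄) > 0. Then there exists ε₀ > 0 such that for every ε with ε·f'''(x̄) > 0 and |ε| < ε₀, setting x₀ = x̄ − ε, there exists a step size η satisfying 2/f''(x̄) < η < 2/(f''(x̄) − ε·f'''(x̄)) such that the gradient-descent iterates x₁ = x₀ − η·f'(x₀) and x₂ = x₁ − η·f'(x₁) satisfy x₂ = x₀ (i.e., gradient descent returns to x₀ after two steps). -/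
open Filter Topology

lemma core_osc (g ρ : ℝ → ℝ) (a b c : ℝ) (ha : 0 < a) (hb : b ≠ 0)
    (hD : 0 < 3 * b ^ 2 - a * c)
    (hg : ∀ u, g u = a * u + b / 2 * u ^ 2 + (c / 6 + ρ u) * u ^ 3)
    (hρ : Tendsto ρ (𝓝 0) (𝓝 0))
    (hc : ∀ᶠ u in 𝓝 (0:ℝ), ContinuousAt g u) :
    ∀ᶠ u in 𝓝 (0:ℝ), u * b < 0 → ∃ η, 2 / a < η ∧ η < 2 / (a + b * u) ∧
      g u + g (u - η * g u) = 0 := by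
  have hid : Tendsto (fun u : ℝ => u) (𝓝 0) (𝓝 0) := tendsto_id
  have hk : Tendsto (fun u => c / 6 + ρ u) (𝓝 0) (𝓝 (c / 6)) := by
    simpa using hρ.const_add (c / 6)
  have hg0 : Tendsto g (𝓝 0) (𝓝 0) := by
    have : g = fun u => a * u + b / 2 * u ^ 2 + (c / 6 + ρ u) * u ^ 3 := funext hg
    rw [this]
    simpa using ((hid.const_mul a).add ((hid.pow 2).const_mul (b / 2))).add (hk.mul (hid.pow 3))
  -- first endpoint
  have hy1 : Tendsto (fun u => u - 2 / a * g u) (𝓝 0) (𝓝 0) := by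
    simpa using hid.sub (hg0.const_mul (2 / a))
  have hk1 := hk.comp hy1
  have hp : Tendsto (fun u => b / a + 2 / a * (c / 6 + ρ u) * u) (𝓝 0) (𝓝 (b / a)) := by
    simpa using ((hk.const_mul (2 / a)).mul hid).const_add (b / a)
  have hH1 : Tendsto (fun u => -(c / 6 + ρ u) + b * (b / a + 2 / a * (c / 6 + ρ u) * u)
      + b / 2 * (b / a + 2 / a * (c / 6 + ρ u) * u) ^ 2 * u
      - (c / 6 + ρ (u - 2 / a * g u)) * (1 + (b / a + 2 / a * (c / 6 + ρ u) * u) * u) ^ 3)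
      (𝓝 0) (𝓝 (-(c / 6) + b * (b / a) + b / 2 * (b / a) ^ 2 * 0
        - c / 6 * (1 + b / a * 0) ^ 3)) :=
    ((hk.neg.add (hp.const_mul b)).add (((hp.pow 2).const_mul (b / 2)).mul hid)).sub
      (hk1.mul (((hp.mul hid).const_add 1).pow 3))
  have hpos1 : 0 < -(c / 6) + b * (b / a) + b / 2 * (b / a) ^ 2 * 0
        - c / 6 * (1 + b / a * 0) ^ 3 := by
    have : -(c / 6) + b * (b / a) + b / 2 * (b / a) ^ 2 * 0
        - c / 6 * (1 + b / a * 0) ^ 3 = (3 * b ^ 2 - a * c) / (3 * a) := by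
      field_simp; ring
    rw [this]; positivity
  have e1 := hH1.eventually (lt_mem_nhds hpos1)
  -- second endpoint
  have hden : Tendsto (fun u => a + b * u) (𝓝 0) (𝓝 a) := by
    simpa using (hid.const_mul b).const_add a
  have heta : Tendsto (fun u => 2 / (a + b * u)) (𝓝 0) (𝓝 (2 / a)) :=
    tendsto_const_nhds.div hden ha.ne'
  have hy2 : Tendsto (fun u => u - 2 / (a + b * u) * g u) (𝓝 0) (𝓝 0) := by
    simpa using hid.sub (heta.mul hg0)
  have hk2 := hk.comp hy2
  have hn : Tendsto (fun u => (b - 2 * (c / 6 + ρ u) * u) / (a + b * u)) (𝓝 0) (𝓝 (b / a)) := by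
    have : Tendsto (fun u => b - 2 * (c / 6 + ρ u) * u) (𝓝 0) (𝓝 b) := by
      simpa using ((hk.const_mul 2).mul hid).const_sub b
    exact this.div hden ha.ne'
  have hm : Tendsto (fun u => -1 + u * ((b - 2 * (c / 6 + ρ u) * u) / (a + b * u)))
      (𝓝 0) (𝓝 (-1)) := by
    simpa using (hid.mul hn).const_add (-1)
  have hH2 : Tendsto (fun u => (b / 2 + (c / 6 + ρ u) * u
      + a * ((b - 2 * (c / 6 + ρ u) * u) / (a + b * u))
      + b / 2 * (-1 + u * ((b - 2 * (c / 6 + ρ u) * u) / (a + b * u))) ^ 2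
      + (c / 6 + ρ (u - 2 / (a + b * u) * g u)) * u
        * (-1 + u * ((b - 2 * (c / 6 + ρ u) * u) / (a + b * u))) ^ 3) * b)
      (𝓝 0) (𝓝 ((b / 2 + c / 6 * 0 + a * (b / a) + b / 2 * (-1) ^ 2
        + c / 6 * 0 * (-1) ^ 3) * b)) :=
    (((((hk.mul hid).const_add (b / 2)).add (hn.const_mul a)).add
      ((hm.pow 2).const_mul (b / 2))).add ((hk2.mul hid).mul (hm.pow 3))).mul_const b
  have hpos2 : 0 < (b / 2 + c / 6 * 0 + a * (b / a) + b / 2 * (-1) ^ 2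
        + c / 6 * 0 * (-1) ^ 3) * b := by
    have : (b / 2 + c / 6 * 0 + a * (b / a) + b / 2 * (-1) ^ 2
        + c / 6 * 0 * (-1) ^ 3) * b = 2 * b ^ 2 := by
      field_simp; ring
    rw [this]; positivity
  have e2 := hH2.eventually (lt_mem_nhds hpos2)
  have e3 := hden.eventually (lt_mem_nhds (half_lt_self ha))
  obtain ⟨δ, hδ, hcδ⟩ := Metric.eventually_nhds_iff.1 hc
  have hB : Tendsto (fun u => |u| + 4 / a * |g u|) (𝓝 0) (𝓝 0) := by
    simpa using hid.abs.add (hg0.abs.const_mul (4 / a))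
  have e4 := hB.eventually (gt_mem_nhds hδ)
  filter_upwards [e1, e2, e3, e4] with u H1 H2 H3 H4 hub
  have hdp : 0 < a + b * u := by linarith
  have hlt : 2 / a < 2 / (a + b * u) := by
    apply div_lt_div_of_pos_left <;> nlinarith
  have hle : 2 / (a + b * u) ≤ 4 / a := by
    rw [div_le_div_iff₀ hdp ha]; nlinarith
  have hcont : ContinuousOn (fun η => b * (g u + g (u - η * g u)))
      (Set.Icc (2 / a) (2 / (a + b * u))) := by
    intro η hη
    have h2a : 0 < 2 / a := by positivity
    have hηp : 0 < η := lt_of_lt_of_le h2a hη.1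
    have hgc : ContinuousAt g (u - η * g u) := by
      apply hcδ
      rw [Real.dist_eq, sub_zero]
      calc |u - η * g u| ≤ |u| + |η * g u| := abs_sub _ _
        _ = |u| + η * |g u| := by rw [abs_mul, abs_of_pos hηp]
        _ ≤ |u| + 4 / a * |g u| := by
          gcongr; exact hη.2.trans hle
        _ < δ := H4
    have : ContinuousAt (fun η => g (u - η * g u)) η :=
      ContinuousAt.comp (f := fun η => u - η * g u) hgc (by fun_prop)
    exact (continuousAt_const.mul (continuousAt_const.add this)).continuousWithinAt
  have v1 : b * (g u + g (u - 2 / a * g u)) < 0 := by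
    have hy : u - 2 / a * g u = -u * (1 + (b / a + 2 / a * (c / 6 + ρ u) * u) * u) := by
      rw [hg u]; field_simp; ring
    have key : b * (g u + g (u - 2 / a * g u)) = (u * b) * u ^ 2 * (-(c / 6 + ρ u)
      + b * (b / a + 2 / a * (c / 6 + ρ u) * u)
      + b / 2 * (b / a + 2 / a * (c / 6 + ρ u) * u) ^ 2 * u
      - (c / 6 + ρ (u - 2 / a * g u)) * (1 + (b / a + 2 / a * (c / 6 + ρ u) * u) * u) ^ 3) := by
      rw [hg (u - 2 / a * g u)]
      generalize ρ (u - 2 / a * g u) = r1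
      rw [hy, hg u]
      field_simp; ring
    rw [key]
    have hu : u ≠ 0 := by rintro rfl; simp at hub
    have : 0 < u ^ 2 := by positivity
    exact mul_neg_of_neg_of_pos (mul_neg_of_neg_of_pos hub this) H1
  have v2 : 0 < b * (g u + g (u - 2 / (a + b * u) * g u)) := by
    have hne := hdp.ne'
    have hy : u - 2 / (a + b * u) * g u
        = u * (-1 + u * ((b - 2 * (c / 6 + ρ u) * u) / (a + b * u))) := by
      rw [hg u]; linear_combination (-2 * u) * mul_inv_cancel₀ hne
    have key : b * (g u + g (u - 2 / (a + b * u) * g u)) = u ^ 2 * ((b / 2 + (c / 6 + ρ u) * u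
      + a * ((b - 2 * (c / 6 + ρ u) * u) / (a + b * u))
      + b / 2 * (-1 + u * ((b - 2 * (c / 6 + ρ u) * u) / (a + b * u))) ^ 2
      + (c / 6 + ρ (u - 2 / (a + b * u) * g u)) * u
        * (-1 + u * ((b - 2 * (c / 6 + ρ u) * u) / (a + b * u))) ^ 3) * b) := by
      rw [hg (u - 2 / (a + b * u) * g u)]
      generalize ρ (u - 2 / (a + b * u) * g u) = r1
      rw [hy, hg u]
      generalize (b - 2 * (c / 6 + ρ u) * u) / (a + b * u) = n
      ring
    rw [key]
    have hu : u ≠ 0 := by rintro rfl; simp at hub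
    have : 0 < u ^ 2 := by positivity
    exact mul_pos this H2
  obtain ⟨η, hη, h0⟩ := intermediate_value_Ioo hlt.le hcont ⟨v1, v2⟩
  exact ⟨η, hη.1, hη.2, (mul_eq_zero.1 h0).resolve_left hb⟩

lemma taylor_deriv_osc (f : ℝ → ℝ) (x : ℝ) (hf : ContDiffAt ℝ 4 f x) (h1 : deriv f x = 0) :
    (∀ᶠ u in 𝓝 (0:ℝ), ContinuousAt (fun u => deriv f (x + u)) u) ∧
    Tendsto (fun u => (deriv f (x + u) - (iteratedDeriv 2 f x * u + iteratedDeriv 3 f x / 2 * u ^ 2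
      + iteratedDeriv 4 f x / 6 * u ^ 3)) / u ^ 3) (𝓝 0) (𝓝 0) := by
  obtain ⟨U, hU, hfU⟩ := hf.contDiffOn (m := 4) le_rfl (by simp)
  obtain ⟨δ, hδ, hball⟩ := Metric.mem_nhds_iff.1 hU
  have hfB := hfU.mono hball
  have hgB : ContDiffOn ℝ (3 : ℕ) (deriv f) (Metric.ball x δ) :=
    hfB.deriv_of_isOpen Metric.isOpen_ball (by norm_num)
  have hx : x ∈ Metric.ball x δ := Metric.mem_ball_self hδ
  have hadd : Tendsto (fun u : ℝ => x + u) (𝓝 0) (𝓝 x) := by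
    have : Continuous (fun u : ℝ => x + u) := by fun_prop
    simpa using this.tendsto 0
  constructor
  · filter_upwards [hadd.eventually (Metric.ball_mem_nhds x hδ)] with u hu
    have : ContinuousAt (deriv f) (x + u) :=
      hgB.continuousOn.continuousAt (Metric.isOpen_ball.mem_nhds hu)
    exact ContinuousAt.comp (f := fun u => x + u) this (by fun_prop)
  · have ht := taylor_isLittleO (convex_ball x δ) hx hgB
    rw [Metric.isOpen_ball.nhdsWithin_eq hx] at ht
    have ht2 := (ht.comp_tendsto hadd).tendsto_div_nhds_zero
    refine ht2.congr fun u => ?_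
    have hi : ∀ n, iteratedDerivWithin n (deriv f) (Metric.ball x δ) x
        = iteratedDeriv (n + 1) f x := fun n => by
      rw [iteratedDerivWithin_of_isOpen Metric.isOpen_ball hx, iteratedDeriv_succ']
    simp only [Function.comp, taylorWithinEval_succ, taylor_within_zero_eval, hi, h1]
    norm_num [Nat.factorial]
    ring

/-- If `f` is C⁴ near a nondegenerate local minimum `x̄` with
`f'''(x̄) ≠ 0` and `3 f'''(x̄)² − f''(x̄) f⁗(x̄) > 0`, then for every sufficiently small
`ε` with `ε · f'''(x̄) > 0` there is a step size `η` strictly between `2/f''(x̄)` and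
`2/(f''(x̄) − ε f'''(x̄))` for which gradient descent started at `x̄ − ε` returns to its
starting point after two steps. -/
theorem stable_oscillation_third_order
    (f : ℝ → ℝ) (xbar : ℝ)
    (hf : ContDiffAt ℝ 4 f xbar)
    (h1 : deriv f xbar = 0)
    (h2 : 0 < iteratedDeriv 2 f xbar)
    (h3 : iteratedDeriv 3 f xbar ≠ 0)
    (h4 : 0 < 3 * (iteratedDeriv 3 f xbar) ^ 2
        - iteratedDeriv 2 f xbar * iteratedDeriv 4 f xbar) :
    ∃ ε₀ > (0 : ℝ), ∀ ε : ℝ, 0 < ε * iteratedDeriv 3 f xbar → |ε| < ε₀ →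
      ∃ η : ℝ,
        2 / iteratedDeriv 2 f xbar < η ∧
        η < 2 / (iteratedDeriv 2 f xbar - ε * iteratedDeriv 3 f xbar) ∧
        ((xbar - ε - η * deriv f (xbar - ε))
          - η * deriv f (xbar - ε - η * deriv f (xbar - ε)) = xbar - ε) := by
  obtain ⟨hc, hρ⟩ := taylor_deriv_osc f xbar hf h1
  have := core_osc (fun u => deriv f (xbar + u)) _ _ _ _ h2 h3 h4 (fun u => ?_) hρ hc
  · obtain ⟨δ, hδ, H⟩ := Metric.eventually_nhds_iff.1 this
    refine ⟨δ, hδ, fun ε hε hlt => ?_⟩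
    obtain ⟨η, e1, e2, e3⟩ := H (y := -ε) (by simpa [Real.dist_eq] using hlt) (by linarith)
    refine ⟨η, e1, ?_, ?_⟩
    · convert e2 using 2; ring
    · simp only [← sub_eq_add_neg] at e3
      have : xbar + (-ε - η * deriv f (xbar - ε)) = xbar - ε - η * deriv f (xbar - ε) := by ring
      rw [this] at e3
      linear_combination (-η) * e3
  · by_cases hu : u = 0
    · subst hu; simp [h1]
    · field_simp; ring
end

section
/- Let k ≥ 4 be an integer and let f : ℝ → ℝ be (k+1)-times continuously differentiable near a point x̄ with f'(x̄) = 0, f''(x̄) > 0, f⁽ʲ⁾(x̄) = 0 for every j with 3 ≤ j ≤ k−1, and f⁽ᵏ⁾(x̄) ≠ 0. Then there exists ε₀ > 0 such that for every ε with 0 < ε < ε₀: (1) if k is odd, f⁽ᵏ⁾(x̄) > 0 and f⁽ᵏ⁺¹⁾(x̄) < 0, then there exists η with 2/f''(x̄) < η < 2/(f''(x̄) − f⁽ᵏ⁾(x̄)·ε^{k−2}) such that starting from x₀ = x̄ − ε, two gradient-descent steps with step size η return to x₀; (2) if k is even and f⁽ᵏ⁾(x̄) < 0, then there exists η with 2/f''(x̄)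 < η < 2/(f''(x̄) + f⁽ᵏ⁾(x̄)·ε^{k−2}) such that starting from x₀ = x̄ − ε, two gradient-descent steps with step size η return to x₀. -/
open Filter Topology

lemma so_ne_top (m : ℕ) : (((m + 2 : ℕ) : WithTop ℕ∞)) ≠ ((⊤ : ℕ∞) : WithTop ℕ∞) := by
  intro h
  exact ENat.coe_ne_top (m + 2) (WithTop.coe_injective h)

lemma so_deriv (m : ℕ) (f : ℝ → ℝ) (x : ℝ) (hf : ContDiffAt ℝ (m + 2 + 1 : ℕ) f x) :
    ContDiffAt ℝ (m + 2 : ℕ) (deriv f) x := by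
  have h := hf.fderiv_right (m := (m + 2 : ℕ)) (by norm_cast)
  exact h.clm_apply contDiffAt_const

/-- Taylor expansion of the derivative. -/
lemma so_taylor (m : ℕ) (hm : 2 ≤ m) (f : ℝ → ℝ) (x : ℝ)
    (hf : ContDiffAt ℝ (m + 2 + 1 : ℕ) f x) (h1 : deriv f x = 0)
    (hzero : ∀ j : ℕ, 3 ≤ j → j ≤ m + 1 → iteratedDeriv j f x = 0) :
    ∃ q : ℝ → ℝ, Tendsto q (𝓝 0) (𝓝 (iteratedDeriv (m + 3) f x / (m + 2).factorial)) ∧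
      ∀ y, deriv f (x + y) = y * (iteratedDeriv 2 f x +
        y ^ m * (iteratedDeriv (m + 2) f x / (m + 1).factorial + y * q y)) := by
  have hg := so_deriv m f x hf
  obtain ⟨u, hu, hgu⟩ := hg.contDiffOn le_rfl (fun h => absurd h (so_ne_top m))
  obtain ⟨δ, hδ, hball⟩ := Metric.mem_nhds_iff.1 hu
  have hx : x ∈ Metric.ball x δ := Metric.mem_ball_self hδ
  have hT := taylor_tendsto (convex_ball x δ) hx (hgu.mono hball)
  rw [Metric.isOpen_ball.nhdsWithin_eq hx] at hT
  have hE : ∀ y, taylorWithinEval (deriv f) (m + 2) (Metric.ball x δ) x (x + y) =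
      y * iteratedDeriv 2 f x + y ^ (m + 1) * (iteratedDeriv (m + 2) f x / (m + 1).factorial)
        + y ^ (m + 2) * (iteratedDeriv (m + 3) f x / (m + 2).factorial) := by
    intro y
    have hD : ∀ j, iteratedDerivWithin j (deriv f) (Metric.ball x δ) x
        = iteratedDeriv (j + 1) f x := by
      intro j
      rw [iteratedDerivWithin_of_isOpen Metric.isOpen_ball hx, iteratedDeriv_succ']
    rw [taylor_within_apply, Finset.sum_range_succ, Finset.sum_range_succ,
      Finset.sum_eq_single 1]
    · simp only [hD, add_sub_cancel_left, smul_eq_mul]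
      simp
      ring
    · intro j hj hj1
      rw [Finset.mem_range] at hj
      rw [hD]
      rcases Nat.eq_zero_or_pos j with rfl | hj0
      · simp [h1]
      · rw [hzero (j + 1) (by omega) (by omega)]; simp
    · intro h
      exact absurd (Finset.mem_range.2 (by omega)) h
  have hT2 : Tendsto (fun y : ℝ => x + y) (𝓝 0) (𝓝 x) := by
    have : ContinuousAt (fun y : ℝ => x + y) 0 := by fun_prop
    simpa [ContinuousAt] using this
  have hT3 := (hT.comp hT2).add_const (iteratedDeriv (m + 3) f x / (m + 2).factorial)
  rw [zero_add] at hT3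
  refine ⟨_, hT3, ?_⟩
  intro y
  simp only [Function.comp, hE, add_sub_cancel_left, smul_eq_mul]
  by_cases hy : y = 0
  · simp [hy, h1]
  · field_simp
    ring

/-- Asymptotics of the residual at `η = 2 / (a + τ ε ^ m)`. -/
lemma so_resid (m : ℕ) (hm : 2 ≤ m) (G ρ : ℝ → ℝ) (a B σ τ : ℝ) (ha : 0 < a)
    (hσ : σ = (-1) ^ m)
    (hρ : Tendsto ρ (𝓝 0) (𝓝 B))
    (hG : ∀ y, G y = y * (a + y ^ m * ρ y)) :
    ∃ s t : ℝ → ℝ, Tendsto s (𝓝 0) (𝓝 1) ∧ Tendsto t (𝓝 0) (𝓝 (2 * (σ * B - τ) / a)) ∧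
      (∀ ε, s ε = 1 + ε ^ m * t ε) ∧
      (∀ ε, t ε = 2 * (σ * ρ (-ε) - τ) / (a + τ * ε ^ m)) ∧
      (∀ᶠ ε in 𝓝 (0:ℝ), a / 2 < a + τ * ε ^ m) ∧
      ∀ᶠ ε in 𝓝 (0:ℝ), G (-ε) + G (-ε - 2 / (a + τ * ε ^ m) * G (-ε)) =
        ε ^ (m + 1) * (a * t ε + s ε ^ (m + 1) * ρ (ε * s ε) - σ * ρ (-ε)) := by
  have hpow : Tendsto (fun ε : ℝ => ε ^ m) (𝓝 0) (𝓝 0) := by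
    have : ContinuousAt (fun ε : ℝ => ε ^ m) 0 := by fun_prop
    simpa [ContinuousAt, show m ≠ 0 by omega] using this
  have hneg : Tendsto (fun ε : ℝ => -ε) (𝓝 0) (𝓝 0) := by
    have : ContinuousAt (fun ε : ℝ => -ε) 0 := by fun_prop
    simpa [ContinuousAt] using this
  have hden : Tendsto (fun ε : ℝ => a + τ * ε ^ m) (𝓝 0) (𝓝 a) := by
    simpa using (hpow.const_mul τ).const_add a
  have ht : Tendsto (fun ε : ℝ => 2 * (σ * ρ (-ε) - τ) / (a + τ * ε ^ m)) (𝓝 0)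
      (𝓝 (2 * (σ * B - τ) / a)) :=
    Tendsto.div ((((hρ.comp hneg).const_mul σ).sub_const τ).const_mul 2) hden ha.ne'
  have hs : Tendsto (fun ε : ℝ => 1 + ε ^ m * (2 * (σ * ρ (-ε) - τ) / (a + τ * ε ^ m))) (𝓝 0)
      (𝓝 1) := by
    simpa using (hpow.mul ht).const_add 1
  have hev : ∀ᶠ ε in 𝓝 (0:ℝ), a / 2 < a + τ * ε ^ m :=
    hden.eventually_const_lt (by linarith)
  refine ⟨_, _, hs, ht, fun _ => rfl, fun _ => rfl, hev, ?_⟩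
  filter_upwards [hev] with ε hε
  have hd : a + τ * ε ^ m ≠ 0 := by linarith
  have hGn : G (-ε) = -ε * (a + σ * ε ^ m * ρ (-ε)) := by
    rw [hG, neg_pow, hσ]
  have hx1 : -ε - 2 / (a + τ * ε ^ m) * G (-ε) =
      ε * (1 + ε ^ m * (2 * (σ * ρ (-ε) - τ) / (a + τ * ε ^ m))) := by
    rw [hGn]; field_simp; ring
  rw [hx1, hGn, hG, mul_pow]
  have hsd : ∃ t, t = 2 * (σ * ρ (-ε) - τ) / (a + τ * ε ^ m) := ⟨_, rfl⟩
  obtain ⟨t, ht⟩ := hsd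
  rw [← ht]
  have hsd : ∃ s, s = 1 + ε ^ m * t := ⟨_, rfl⟩
  obtain ⟨s, hs⟩ := hsd
  rw [← hs, pow_succ, pow_succ]
  linear_combination (a * ε) * hs

/-- Intermediate value step. -/
lemma so_ivt (m : ℕ) (G : ℝ → ℝ) (a τ : ℝ) (ha : 0 < a) (hτ : τ < 0)
    (hG0 : G 0 = 0) (hc : ∀ᶠ y in 𝓝 (0:ℝ), ContinuousAt G y)
    (hev : ∀ᶠ ε in 𝓝[>] (0:ℝ), a / 2 < a + τ * ε ^ m)
    (hlo : ∀ᶠ ε in 𝓝[>] (0:ℝ), G (-ε) + G (-ε - 2 / a * G (-ε)) < 0)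
    (hhi : ∀ᶠ ε in 𝓝[>] (0:ℝ), 0 < G (-ε) + G (-ε - 2 / (a + τ * ε ^ m) * G (-ε))) :
    ∀ᶠ ε in 𝓝[>] (0:ℝ), ∃ η, 2 / a < η ∧ η < 2 / (a + τ * ε ^ m) ∧
      G (-ε) + G (-ε - η * G (-ε)) = 0 := by
  obtain ⟨δ, hδ, hcδ⟩ := Metric.eventually_nhds_iff.1 hc
  have hsmall : ∀ᶠ ε in 𝓝[>] (0:ℝ), |ε| + 4 / a * |G (-ε)| < δ := by
    apply eventually_nhdsWithin_of_eventually_nhds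
    have hG' : ContinuousAt G (-0) := by
      rw [neg_zero]; exact hc.self_of_nhds
    have : ContinuousAt (fun ε : ℝ => |ε| + 4 / a * |G (-ε)|) 0 :=
      continuousAt_id.abs.add (((hG'.comp continuousAt_neg).abs).const_mul _)
    apply Tendsto.eventually_lt_const (u := δ) _ this
    simpa [hG0] using hδ
  filter_upwards [hev, hlo, hhi, hsmall, self_mem_nhdsWithin] with ε h1 h2 h3 h4 hε
  have hε : 0 < ε := hε
  have hlt : 2 / a ≤ 2 / (a + τ * ε ^ m) := by
    apply div_le_div_of_nonneg_left (by norm_num) (by linarith)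
    nlinarith [pow_pos hε m]
  have hcont : ContinuousOn (fun η => G (-ε) + G (-ε - η * G (-ε)))
      (Set.Icc (2 / a) (2 / (a + τ * ε ^ m))) := by
    intro η hη
    apply ContinuousAt.continuousWithinAt
    apply continuousAt_const.add
    apply ContinuousAt.comp (g := G) (f := fun η => -ε - η * G (-ε))
    · apply hcδ
      rw [dist_zero_right, Real.norm_eq_abs]
      have hη0 : 0 ≤ η := le_trans (by positivity) hη.1
      have hη4 : η ≤ 4 / a := by
        refine hη.2.trans ?_
        rw [div_le_div_iff₀ (by linarith) ha]
        linarith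
      calc |-ε - η * G (-ε)| ≤ |-ε| + |η * G (-ε)| := abs_sub _ _
        _ = |ε| + η * |G (-ε)| := by rw [abs_neg, abs_mul, abs_of_nonneg hη0]
        _ ≤ |ε| + 4 / a * |G (-ε)| := by gcongr
        _ < δ := h4
    · fun_prop
  obtain ⟨η, hη, hz⟩ := intermediate_value_Ioo hlt hcont ⟨h2, h3⟩
  exact ⟨η, hη.1, hη.2, hz⟩

/-- Sign of a product `ε ^ n * L ε`. -/
lemma so_sign_pos (n : ℕ) (F L : ℝ → ℝ) (l : ℝ) (hl : 0 < l) (hL : Tendsto L (𝓝 0) (𝓝 l))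
    (hF : ∀ᶠ ε in 𝓝 (0:ℝ), F ε = ε ^ n * L ε) : ∀ᶠ ε in 𝓝[>] (0:ℝ), 0 < F ε := by
  filter_upwards [eventually_nhdsWithin_of_eventually_nhds hF,
    eventually_nhdsWithin_of_eventually_nhds (hL.eventually_const_lt hl),
    self_mem_nhdsWithin] with ε h1 h2 h3
  rw [h1]
  exact mul_pos (pow_pos h3 n) h2

lemma so_sign_neg (n : ℕ) (F L : ℝ → ℝ) (l : ℝ) (hl : l < 0) (hL : Tendsto L (𝓝 0) (𝓝 l))
    (hF : ∀ᶠ ε in 𝓝 (0:ℝ), F ε = ε ^ n * L ε) : ∀ᶠ ε in 𝓝[>] (0:ℝ), F ε < 0 := by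
  have := so_sign_pos n (fun ε => -F ε) (fun ε => -L ε) (-l) (by linarith) hL.neg
    (by filter_upwards [hF] with ε h; rw [h]; ring)
  filter_upwards [this] with ε h
  linarith

/-- Core statement for `G`. -/
lemma so_core (m : ℕ) (hm : 2 ≤ m) (G q : ℝ → ℝ) (a B C : ℝ) (ha : 0 < a)
    (hq : Tendsto q (𝓝 0) (𝓝 C)) (hG : ∀ y, G y = y * (a + y ^ m * (B + y * q y)))
    (hc : ∀ᶠ y in 𝓝 (0:ℝ), ContinuousAt G y) (σ τ : ℝ) (hσ : σ = (-1) ^ m) (hτ : τ < 0)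
    (hpos : 0 < (1 + σ) * B - 2 * τ)
    (hneg : (σ = 1 ∧ B < 0) ∨ (σ = -1 ∧ C < 0)) :
    ∀ᶠ ε in 𝓝[>] (0:ℝ), ∃ η, 2 / a < η ∧ η < 2 / (a + τ * ε ^ m) ∧
      G (-ε) + G (-ε - η * G (-ε)) = 0 := by
  have hid : Tendsto (fun ε : ℝ => ε) (𝓝 0) (𝓝 0) := tendsto_id
  have hρ : Tendsto (fun y => B + y * q y) (𝓝 0) (𝓝 B) := by
    simpa using (hid.mul hq).const_add B
  have hnegt : Tendsto (fun ε : ℝ => -ε) (𝓝 0) (𝓝 0) := by simpa using hid.neg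
  have hL : ∀ s t : ℝ → ℝ, ∀ τ : ℝ, Tendsto s (𝓝 0) (𝓝 1) →
      Tendsto t (𝓝 0) (𝓝 (2 * (σ * B - τ) / a)) →
      Tendsto (fun ε => a * t ε + s ε ^ (m + 1) * (B + (ε * s ε) * q (ε * s ε))
        - σ * (B + (-ε) * q (-ε))) (𝓝 0) (𝓝 ((1 + σ) * B - 2 * τ)) := by
    intro s t τ hs ht
    have hes : Tendsto (fun ε => ε * s ε) (𝓝 0) (𝓝 0) := by simpa using hid.mul hs
    have := ((ht.const_mul a).add ((hs.pow (m + 1)).mul (hρ.comp hes))).sub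
      ((hρ.comp hnegt).const_mul σ)
    have e : a * (2 * (σ * B - τ) / a) + 1 ^ (m + 1) * B - σ * B = (1 + σ) * B - 2 * τ := by
      rw [one_pow]; field_simp; ring
    rw [e] at this
    exact this
  obtain ⟨s, t, hs, ht, -, -, hev, hF⟩ := so_resid m hm G _ a B σ τ ha hσ hρ hG
  obtain ⟨s', t', hs', ht', hst', htt', -, hF'⟩ := so_resid m hm G _ a B σ 0 ha hσ hρ hG
  simp only [zero_mul, add_zero] at hF' htt'
  refine so_ivt m G a τ ha hτ (by simp [hG]) hc
    (eventually_nhdsWithin_of_eventually_nhds hev) ?_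
    (so_sign_pos (m + 1) _ _ _ hpos (hL s t τ hs ht) hF)
  rcases hneg with ⟨h1, hB⟩ | ⟨h1, hC⟩
  · exact so_sign_neg (m + 1) _ _ _ (by rw [h1]; linarith) (hL s' t' 0 hs' ht') hF'
  · have hes : Tendsto (fun ε => ε * s' ε) (𝓝 0) (𝓝 0) := by simpa using hid.mul hs'
    have hpow : Tendsto (fun ε : ℝ => ε ^ (m - 1)) (𝓝 0) (𝓝 0) := by
      have := hid.pow (m - 1)
      simpa [show m - 1 ≠ 0 by omega] using this
    have hsum : Tendsto (fun ε => ∑ i ∈ Finset.range (m + 1), s' ε ^ i) (𝓝 0)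
        (𝓝 (∑ i ∈ Finset.range (m + 1), (1:ℝ) ^ i)) :=
      tendsto_finsetSum _ (fun i _ => hs'.pow i)
    have hlim := (((hsum.mul (hpow.mul ht')).const_mul B).add
      ((hs'.pow (m + 2)).mul (hq.comp hes))).add (hq.comp hnegt)
    refine so_sign_neg (m + 2) _ (fun ε =>
      B * ((∑ i ∈ Finset.range (m + 1), s' ε ^ i) * (ε ^ (m - 1) * t' ε)) +
        s' ε ^ (m + 2) * q (ε * s' ε) + q (-ε)) (2 * C) (by linarith) ?_ ?_
    · have e : ∀ S T : ℝ, B * (S * (0 * T)) + 1 ^ (m + 2) * C + C = 2 * C := by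
        intro S T
        rw [one_pow]; ring
      rw [e] at hlim
      exact hlim
    · filter_upwards [hF'] with ε h
      rw [h]
      have e1 : (∑ i ∈ Finset.range (m + 1), s' ε ^ i) * (s' ε - 1) = s' ε ^ (m + 1) - 1 :=
        geom_sum_mul _ _
      have e2 : s' ε - 1 = ε * (ε ^ (m - 1) * t' ε) := by
        rw [hst' ε, ← mul_assoc, ← pow_succ', show m - 1 + 1 = m by omega]; ring
      have e3 : a * t' ε = -2 * (B + (-ε) * q (-ε)) := by
        rw [htt' ε, h1]; field_simp; ring
      rw [e2] at e1
      rw [e3, h1]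
      linear_combination (-B * ε ^ (m + 1)) * e1

/-- Higher-order version of the stable-oscillation criterion: if the
lowest nonvanishing derivative of `f` at the minimum `x̄` beyond `f''` has order `k ≥ 4`,
then in either parity case (with the corresponding sign condition) there is a step size
`η` slightly above `2/f''(x̄)` for which two gradient-descent steps from `x̄ − ε`
return to `x̄ − ε`. -/
theorem stable_oscillation_higher_order
    (k : ℕ) (hk : 4 ≤ k) (f : ℝ → ℝ) (xbar : ℝ)
    (hf : ContDiffAt ℝ (k + 1 : ℕ) f xbar)
    (h1 : deriv f xbar = 0)
    (h2 : 0 < iteratedDeriv 2 f xbar)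
    (hzero : ∀ j : ℕ, 3 ≤ j → j ≤ k - 1 → iteratedDeriv j f xbar = 0)
    (hknz : iteratedDeriv k f xbar ≠ 0) :
    ∃ ε₀ > (0 : ℝ), ∀ ε : ℝ, 0 < ε → ε < ε₀ →
      ((Odd k → 0 < iteratedDeriv k f xbar → iteratedDeriv (k + 1) f xbar < 0 →
        ∃ η : ℝ,
          2 / iteratedDeriv 2 f xbar < η ∧
          η < 2 / (iteratedDeriv 2 f xbar - iteratedDeriv k f xbar * ε ^ (k - 2)) ∧
          ((xbar - ε - η * deriv f (xbar - ε))
            - η * deriv f (xbar - ε - η * deriv f (xbar - ε)) = xbar - ε)) ∧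
      (Even k → iteratedDeriv k f xbar < 0 →
        ∃ η : ℝ,
          2 / iteratedDeriv 2 f xbar < η ∧
          η < 2 / (iteratedDeriv 2 f xbar + iteratedDeriv k f xbar * ε ^ (k - 2)) ∧
          ((xbar - ε - η * deriv f (xbar - ε))
            - η * deriv f (xbar - ε - η * deriv f (xbar - ε)) = xbar - ε))) := by
  obtain ⟨m, rfl⟩ : ∃ m, k = m + 2 := ⟨k - 2, by omega⟩
  have hm : 2 ≤ m := by omega
  obtain ⟨q, hq, hG⟩ := so_taylor m hm f xbar hf h1 (fun j h3 hj => hzero j h3 (by omega))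
  simp only [show m + 2 - 2 = m by omega]
  have hfac : (1:ℝ) < ((m + 1).factorial : ℝ) := by
    exact_mod_cast Nat.one_lt_factorial.2 (by omega)
  have hfac2 : (0:ℝ) < ((m + 2).factorial : ℝ) := by positivity
  have hc : ∀ᶠ y in 𝓝 (0:ℝ), ContinuousAt (fun y => deriv f (xbar + y)) y := by
    have hev : ∀ᶠ z in 𝓝 xbar, ContinuousAt (deriv f) z := by
      filter_upwards [(so_deriv m f xbar hf).eventually (so_ne_top m)] with z hz
      exact hz.continuousAt
    have hT2 : Tendsto (fun y : ℝ => xbar + y) (𝓝 0) (𝓝 xbar) := by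
      have : ContinuousAt (fun y : ℝ => xbar + y) 0 := by fun_prop
      simpa [ContinuousAt] using this
    filter_upwards [hT2.eventually hev] with y hy
    exact ContinuousAt.comp (g := deriv f) (f := fun y => xbar + y) hy (by fun_prop)
  have key := so_core m hm (fun y => deriv f (xbar + y)) q (iteratedDeriv 2 f xbar)
    (iteratedDeriv (m + 2) f xbar / (m + 1).factorial)
    (iteratedDeriv (m + 3) f xbar / (m + 2).factorial) h2 hq hG hc
  have fin : ∀ ε η : ℝ, deriv f (xbar + -ε) + deriv f (xbar + (-ε - η * deriv f (xbar + -ε))) = 0 →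
      ((xbar - ε - η * deriv f (xbar - ε))
            - η * deriv f (xbar - ε - η * deriv f (xbar - ε)) = xbar - ε) := by
    intro ε η h
    rw [← sub_eq_add_neg, show xbar + (-ε - η * deriv f (xbar - ε)) =
      xbar - ε - η * deriv f (xbar - ε) by ring] at h
    linear_combination (-η) * h
  have main : ∀ᶠ ε in 𝓝[>] (0:ℝ),
      ((Odd (m + 2) → 0 < iteratedDeriv (m + 2) f xbar → iteratedDeriv (m + 2 + 1) f xbar < 0 →
        ∃ η : ℝ,
          2 / iteratedDeriv 2 f xbar < η ∧
          η < 2 / (iteratedDeriv 2 f xbar - iteratedDeriv (m + 2) f xbar * ε ^ m) ∧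
          ((xbar - ε - η * deriv f (xbar - ε))
            - η * deriv f (xbar - ε - η * deriv f (xbar - ε)) = xbar - ε)) ∧
      (Even (m + 2) → iteratedDeriv (m + 2) f xbar < 0 →
        ∃ η : ℝ,
          2 / iteratedDeriv 2 f xbar < η ∧
          η < 2 / (iteratedDeriv 2 f xbar + iteratedDeriv (m + 2) f xbar * ε ^ m) ∧
          ((xbar - ε - η * deriv f (xbar - ε))
            - η * deriv f (xbar - ε - η * deriv f (xbar - ε)) = xbar - ε))) := by
    apply Filter.Eventually.and
    · by_cases hA : Odd (m + 2) ∧ 0 < iteratedDeriv (m + 2) f xbar ∧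
          iteratedDeriv (m + 2 + 1) f xbar < 0
      · obtain ⟨ho, hb, hC⟩ := hA
        have hσ : (-1:ℝ) = (-1) ^ m := by
          rw [Odd.neg_one_pow]
          rw [Nat.odd_iff] at *; omega
        have := key (-1) (-iteratedDeriv (m + 2) f xbar) hσ (by linarith) (by linarith)
          (Or.inr ⟨rfl, div_neg_of_neg_of_pos hC hfac2⟩)
        filter_upwards [this] with ε hε _ _ _
        obtain ⟨η, e1, e2, e3⟩ := hε
        refine ⟨η, e1, ?_, fin ε η e3⟩
        rwa [neg_mul, ← sub_eq_add_neg] at e2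
      · exact Filter.Eventually.of_forall fun ε a1 a2 a3 => absurd ⟨a1, a2, a3⟩ hA
    · by_cases hA : Even (m + 2) ∧ iteratedDeriv (m + 2) f xbar < 0
      · obtain ⟨ho, hb⟩ := hA
        have hσ : (1:ℝ) = (-1) ^ m := by
          rw [Even.neg_one_pow]
          rw [Nat.even_iff] at *; omega
        have hB : iteratedDeriv (m + 2) f xbar <
            iteratedDeriv (m + 2) f xbar / (m + 1).factorial := by
          rw [lt_div_iff₀ (by linarith)]
          nlinarith
        have := key 1 (iteratedDeriv (m + 2) f xbar) hσ hb (by linarith)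
          (Or.inl ⟨rfl, div_neg_of_neg_of_pos hb (by linarith)⟩)
        filter_upwards [this] with ε hε _ _
        obtain ⟨η, e1, e2, e3⟩ := hε
        exact ⟨η, e1, e2, fin ε η e3⟩
      · exact Filter.Eventually.of_forall fun ε a1 a2 => absurd ⟨a1, a2⟩ hA
  obtain ⟨ε₀, h0, hsub⟩ := mem_nhdsGT_iff_exists_Ioo_subset.1 main
  exact ⟨ε₀, h0, fun ε e1 e2 => hsub ⟨e1, e2⟩⟩
end

section
/- Let g : ℝ → ℝ be four times continuously differentiable near x̄, let y ∈ ℝ with g(x̄) = y, g'(x̄) ≠ 0, and g'(x̄)·g'''(x̄) < 6·g''(x̄)². Define f(x) = (g(x) − y)². Then f'(x̄) = 0, f''(x̄) = 2·g'(x̄)² > 0, f'''(x̄) = 6·g''(x̄)·g'(x̄), and f⁽⁴⁾(x̄) = 6·g''(x̄)² + 8·g'(x̄)·g'''(x̄). Consequently: if g''(x̄) ≠ 0 then f'''(x̄) ≠ 0 and 3·f'''(x̄)² − f''(x̄)·f⁽⁴⁾(x̄) > 0; and if g''(x̄) = 0 then f'''(x̄) = 0 and f⁽⁴⁾(x̄)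 < 0. -/
/-- For a squared loss `f(x) = (g(x) − y)²` at a point `x̄` with
`g(x̄) = y`, `g'(x̄) ≠ 0` and `g'(x̄) g'''(x̄) < 6 g''(x̄)²`, the derivatives of `f` at `x̄`
are as computed, and they satisfy the hypotheses of the stable-oscillation criteria
(third-order when `g''(x̄) ≠ 0`, fourth-order with negative sign when `g''(x̄) = 0`). -/
theorem squared_loss_oscillation_condition
    (g : ℝ → ℝ) (xbar y : ℝ)
    (hg : ContDiffAt ℝ 4 g xbar)
    (hgy : g xbar = y)
    (hg1 : deriv g xbar ≠ 0)
    (hg3 : deriv g xbar * iteratedDeriv 3 g xbar < 6 * (iteratedDeriv 2 g xbar) ^ 2) :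
    deriv (fun x => (g x - y) ^ 2) xbar = 0 ∧
    iteratedDeriv 2 (fun x => (g x - y) ^ 2) xbar = 2 * (deriv g xbar) ^ 2 ∧
    0 < iteratedDeriv 2 (fun x => (g x - y) ^ 2) xbar ∧
    iteratedDeriv 3 (fun x => (g x - y) ^ 2) xbar
      = 6 * iteratedDeriv 2 g xbar * deriv g xbar ∧
    iteratedDeriv 4 (fun x => (g x - y) ^ 2) xbar
      = 6 * (iteratedDeriv 2 g xbar) ^ 2 + 8 * deriv g xbar * iteratedDeriv 3 g xbar ∧
    (iteratedDeriv 2 g xbar ≠ 0 →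
      iteratedDeriv 3 (fun x => (g x - y) ^ 2) xbar ≠ 0 ∧
      0 < 3 * (iteratedDeriv 3 (fun x => (g x - y) ^ 2) xbar) ^ 2
        - iteratedDeriv 2 (fun x => (g x - y) ^ 2) xbar
          * iteratedDeriv 4 (fun x => (g x - y) ^ 2) xbar) ∧
    (iteratedDeriv 2 g xbar = 0 →
      iteratedDeriv 3 (fun x => (g x - y) ^ 2) xbar = 0 ∧
      iteratedDeriv 4 (fun x => (g x - y) ^ 2) xbar < 0) := by
  have hh : ContDiffAt ℝ 4 (fun x => g x - y) xbar := hg.sub contDiffAt_const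
  have hd : ∀ n : ℕ, iteratedDeriv (n + 1) (fun x => g x - y) = iteratedDeriv (n + 1) g := by
    intro n
    have h1 : deriv (fun x => g x - y) = deriv g := by
      funext x
      simp
    rw [iteratedDeriv_succ', iteratedDeriv_succ', h1]
  have e1 : iteratedDeriv 1 (fun x => g x - y) xbar = deriv g xbar := by
    rw [hd 0]; simp
  have e2 := congrFun (hd 1) xbar
  have e3 := congrFun (hd 2) xbar
  norm_num at e2 e3
  have hsq : (fun x => (g x - y) ^ 2) = (fun x => g x - y) * (fun x => g x - y) := by
    funext x
    simp [sq]
  have key : ∀ n : ℕ, n ≤ 4 → iteratedDeriv n (fun x => (g x - y) ^ 2) xbar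
      = ∑ i ∈ Finset.range (n + 1), (n.choose i : ℝ) * iteratedDeriv i (fun x => g x - y) xbar
        * iteratedDeriv (n - i) (fun x => g x - y) xbar := by
    intro n hn
    have hc : ContDiffAt ℝ n (fun x => g x - y) xbar := hh.of_le (by exact_mod_cast hn)
    rw [hsq, iteratedDeriv_mul hc hc]
  have e0 : iteratedDeriv 0 (fun x => g x - y) xbar = 0 := by simp [hgy]
  have c42 : Nat.choose 4 2 = 6 := rfl
  have c43 : Nat.choose 4 3 = 4 := rfl
  have k1 : deriv (fun x => (g x - y) ^ 2) xbar = 0 := by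
    rw [← iteratedDeriv_one, key 1 (by norm_num)]
    simp only [Finset.sum_range_succ, Finset.sum_range_zero, Nat.sub_self, e0]
    ring
  have k2 : iteratedDeriv 2 (fun x => (g x - y) ^ 2) xbar = 2 * (deriv g xbar) ^ 2 := by
    rw [key 2 (by norm_num)]
    simp only [Finset.sum_range_succ, Finset.sum_range_zero, Nat.reduceSub, e0, e1, e2]
    norm_num
    ring
  have k3 : iteratedDeriv 3 (fun x => (g x - y) ^ 2) xbar
      = 6 * iteratedDeriv 2 g xbar * deriv g xbar := by
    rw [key 3 (by norm_num)]
    simp only [Finset.sum_range_succ, Finset.sum_range_zero, Nat.reduceSub, e0, e1, e2, e3]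
    norm_num
    ring
  have k4 : iteratedDeriv 4 (fun x => (g x - y) ^ 2) xbar
      = 6 * (iteratedDeriv 2 g xbar) ^ 2 + 8 * deriv g xbar * iteratedDeriv 3 g xbar := by
    rw [key 4 (by norm_num)]
    simp only [Finset.sum_range_succ, Finset.sum_range_zero, Nat.reduceSub, e0, e1, e2, e3,
      c42, c43]
    norm_num
    ring
  have hp : 0 < (deriv g xbar) ^ 2 := by positivity
  rw [k1, k2, k3, k4]
  refine ⟨rfl, rfl, by positivity, rfl, rfl, ?_, ?_⟩
  · intro hb
    refine ⟨by simp [hb, hg1], ?_⟩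
    have := mul_pos hp (sub_pos.2 hg3)
    nlinarith
  · intro hb
    rw [hb] at hg3 ⊢
    refine ⟨by ring, ?_⟩
    nlinarith
end

section
/- Let f(x) = sin(x) and let x̄ be a local minimum of f, i.e., sin(x̄) = −1 (so f''(x̄) = 1, f'''(x̄) = 0, f⁽⁴⁾(x̄) = −1). Then there exists ε₀ > 0 such that for every ε with 0 < ε < ε₀ there exists a step size η with 2 < η < 2/(1 − ε²) such that starting from x₀ = x̄ − ε, the gradient-descent iterates x₁ = x₀ − η·cos(x₀) and x₂ = x₁ − η·cos(x₁) satisfy x₂ = x₀. -/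
open Real

/-- At any local minimum `x̄` of `sin` (i.e. `sin x̄ = −1`), for every
sufficiently small `ε > 0` there is a step size `η` with `2 < η < 2/(1 − ε²)` such that
gradient descent on `sin` (whose derivative is `cos`) started at `x̄ − ε` returns to its
starting point after two steps. -/
theorem sin_stable_oscillation (xbar : ℝ) (hmin : Real.sin xbar = -1) :
    ∃ ε₀ > (0 : ℝ), ∀ ε : ℝ, 0 < ε → ε < ε₀ →
      ∃ η : ℝ, 2 < η ∧ η < 2 / (1 - ε ^ 2) ∧
        ((xbar - ε - η * Real.cos (xbar - ε))
          - η * Real.cos (xbar - ε - η * Real.cos (xbar - ε)) = xbar - ε) := by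
  have hc : Real.cos xbar = 0 := by
    have h := Real.sin_sq_add_cos_sq xbar
    rw [hmin] at h
    have h2 : Real.cos xbar ^ 2 = 0 := by linarith
    exact pow_eq_zero_iff (two_ne_zero) |>.mp h2
  refine ⟨1, one_pos, fun ε h0 h1 => ?_⟩
  have hlt : Real.sin ε < ε := Real.sin_lt h0
  have hgt : ε - ε ^ 3 / 6 < Real.sin ε := Real.sin_gt_sub_cube h0
  have hpos : 0 < Real.sin ε := Real.sin_pos_of_pos_of_lt_pi h0 (by linarith [Real.pi_gt_three])
  have hm : Real.cos (xbar - ε) = -Real.sin ε := by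
    rw [Real.cos_sub, hc, hmin]; ring
  have hp : Real.cos (xbar + ε) = Real.sin ε := by
    rw [Real.cos_add, hc, hmin]; ring
  have h3 : 0 < ε ^ 3 := by positivity
  have hs : 2 * ε / Real.sin ε * Real.sin ε = 2 * ε := div_mul_cancel₀ _ hpos.ne'
  refine ⟨2 * ε / Real.sin ε, ?_, ?_, ?_⟩
  · rw [lt_div_iff₀ hpos]; linarith
  · rw [div_lt_div_iff₀ hpos (by nlinarith)]
    nlinarith
  · have hx : xbar - ε - 2 * ε / Real.sin ε * Real.cos (xbar - ε) = xbar + ε := by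
      rw [hm]; linarith
    rw [hx, hp]; linarith
end

section
/- Let f(x) = (x² − 1)² and x̄ = 1, so f''(1) = 8 and f'''(1) = 24. Then there exists ε₀ > 0 such that for every ε with 0 < ε < ε₀ there exists a step size η with 1/4 < η < 2/(8 − 24·ε) such that starting from x₀ = 1 − ε, the gradient-descent iterates x₁ = x₀ − η·f'(x₀) and x₂ = x₁ − η·f'(x₁) satisfy x₂ = x₀. -/
/-- For `f(x) = (x² − 1)²` at the minimum `x̄ = 1` (where `f''(1) = 8`
and `f'''(1) = 24`), for every sufficiently small `ε > 0` there is a step size `η` with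
`1/4 < η < 2/(8 − 24 ε)` such that gradient descent started at `1 − ε` returns to its
starting point after two steps. -/
theorem quartic_stable_oscillation :
    ∃ ε₀ > (0 : ℝ), ∀ ε : ℝ, 0 < ε → ε < ε₀ →
      ∃ η : ℝ, 1 / 4 < η ∧ η < 2 / (8 - 24 * ε) ∧
        ((1 - ε - η * deriv (fun x : ℝ => (x ^ 2 - 1) ^ 2) (1 - ε))
          - η * deriv (fun x : ℝ => (x ^ 2 - 1) ^ 2)
              (1 - ε - η * deriv (fun x : ℝ => (x ^ 2 - 1) ^ 2) (1 - ε)) = 1 - ε) := by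
  have hd : ∀ y : ℝ, deriv (fun x : ℝ => (x ^ 2 - 1) ^ 2) y = 4 * (y ^ 3 - y) := by
    intro y
    have h := ((((hasDerivAt_id y).pow 2).sub_const 1).pow 2).deriv
    simp only [id] at h
    refine Eq.trans ?_ (h.trans ?_)
    · rfl
    · simp
      ring
  refine ⟨1 / 10, by norm_num, fun ε h0 h1 => ?_⟩
  simp only [hd]
  obtain ⟨s, hs0, hs⟩ : ∃ s : ℝ, 0 ≤ s ∧ s ^ 2 = 1 + 6 * ε - 3 * ε ^ 2 :=
    ⟨√(1 + 6 * ε - 3 * ε ^ 2), Real.sqrt_nonneg _, Real.sq_sqrt (by nlinarith)⟩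
  have hD : 0 < 8 * ε * (1 - ε) * (2 - ε) := by
    have : 0 < 1 - ε := by linarith
    have : 0 < 2 - ε := by linarith
    positivity
  have e2 : 0 < ε ^ 2 := by positivity
  have e3 : 0 < ε ^ 3 := by positivity
  have hlow : 1 + 3 * ε - 6 * ε ^ 2 + 2 * ε ^ 3 < s := by
    apply lt_of_pow_lt_pow_left₀ 2 hs0
    rw [hs]
    have : 0 < ε ^ 3 * (32 - 48 * ε + 24 * ε ^ 2 - 4 * ε ^ 3) := by
      apply mul_pos e3
      have : ε ^ 3 < 1 := pow_lt_one₀ h0.le (by linarith) (by norm_num)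
      linarith
    nlinarith
  have hup : s < 1 + 3 * ε := by
    apply lt_of_pow_lt_pow_left₀ 2 (by linarith)
    rw [hs]
    nlinarith
  have hη : (s - (1 - ε)) / (8 * ε * (1 - ε) * (2 - ε)) * (4 * ((1 - ε) ^ 3 - (1 - ε)))
      = -((s - (1 - ε)) / 2) := by
    have : 4 * ((1 - ε) ^ 3 - (1 - ε)) = -(8 * ε * (1 - ε) * (2 - ε)) / 2 := by ring
    rw [this]
    generalize 8 * ε * (1 - ε) * (2 - ε) = D at *
    field_simp
  refine ⟨(s - (1 - ε)) / (8 * ε * (1 - ε) * (2 - ε)), ?_, ?_, ?_⟩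
  · rw [div_lt_div_iff₀ (by norm_num) hD]
    nlinarith
  · rw [div_lt_div_iff₀ hD (by linarith)]
    have : (s - (1 - ε)) * (8 - 24 * ε) < (4 * ε) * (8 - 24 * ε) :=
      mul_lt_mul_of_pos_right (by linarith) (by linarith)
    nlinarith
  · have hb : 4 * ((1 - ε + (s - (1 - ε)) / 2) ^ 3 - (1 - ε + (s - (1 - ε)) / 2))
        = -(4 * ((1 - ε) ^ 3 - (1 - ε))) := by
      linear_combination (s / 2 + 3 * (1 - ε) / 2) * hs
    rw [hη, sub_neg_eq_add, hb, mul_neg, hη]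
    ring
end

section
/- Let y ∈ (−1, 1), let x̄ ∈ (−π/2, π/2) with sin(x̄) = y, and define f(x) = (sin(x) − y)². Then f'(x̄) = 0 and f''(x̄) = 2·cos²(x̄) > 0; moreover, if y ≠ 0 then f'''(x̄) ≠ 0 and 3·f'''(x̄)² − f''(x̄)·f⁽⁴⁾(x̄) > 0, while if y = 0 then f'''(x̄) = 0 and f⁽⁴⁾(x̄) < 0. -/
open Real

/-- For `f(x) = (sin x − y)²` with `y ∈ (−1,1)`, `x̄ ∈ (−π/2, π/2)` and
`sin x̄ = y`: `f'(x̄) = 0`, `f''(x̄) = 2 cos² x̄ > 0`; if `y ≠ 0` then `f'''(x̄) ≠ 0` and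
`3 f'''(x̄)² − f''(x̄) f⁗(x̄) > 0`, while if `y = 0` then `f'''(x̄) = 0` and `f⁗(x̄) < 0`. -/
theorem sin_squared_loss_oscillation_condition
    (y xbar : ℝ) (hy : y ∈ Set.Ioo (-1 : ℝ) 1)
    (hx : xbar ∈ Set.Ioo (-(Real.pi / 2)) (Real.pi / 2))
    (hsin : Real.sin xbar = y) :
    deriv (fun x => (Real.sin x - y) ^ 2) xbar = 0 ∧
    iteratedDeriv 2 (fun x => (Real.sin x - y) ^ 2) xbar = 2 * Real.cos xbar ^ 2 ∧
    0 < iteratedDeriv 2 (fun x => (Real.sin x - y) ^ 2) xbar ∧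
    (y ≠ 0 →
      iteratedDeriv 3 (fun x => (Real.sin x - y) ^ 2) xbar ≠ 0 ∧
      0 < 3 * (iteratedDeriv 3 (fun x => (Real.sin x - y) ^ 2) xbar) ^ 2
        - iteratedDeriv 2 (fun x => (Real.sin x - y) ^ 2) xbar
          * iteratedDeriv 4 (fun x => (Real.sin x - y) ^ 2) xbar) ∧
    (y = 0 →
      iteratedDeriv 3 (fun x => (Real.sin x - y) ^ 2) xbar = 0 ∧
      iteratedDeriv 4 (fun x => (Real.sin x - y) ^ 2) xbar < 0) := by
  have d1 : deriv (fun x => (Real.sin x - y) ^ 2)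
      = fun x => 2 * (Real.sin x - y) * Real.cos x := by
    funext x
    apply HasDerivAt.deriv
    convert ((Real.hasDerivAt_sin x).sub_const y).fun_pow 2 using 1
    · rfl
    · simp
  have d2 : deriv (fun x => 2 * (Real.sin x - y) * Real.cos x)
      = fun x => 2 * Real.cos x ^ 2 - 2 * (Real.sin x - y) * Real.sin x := by
    funext x
    apply HasDerivAt.deriv
    convert (((Real.hasDerivAt_sin x).sub_const y).const_mul 2).fun_mul
      (Real.hasDerivAt_cos x) using 1
    · rfl
    · ring
  have d3 : deriv (fun x => 2 * Real.cos x ^ 2 - 2 * (Real.sin x - y) * Real.sin x)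
      = fun x => -6 * (Real.sin x * Real.cos x) - 2 * (Real.sin x - y) * Real.cos x := by
    funext x
    apply HasDerivAt.deriv
    convert (((Real.hasDerivAt_cos x).fun_pow 2).const_mul 2).fun_sub
      ((((Real.hasDerivAt_sin x).sub_const y).const_mul 2).fun_mul
      (Real.hasDerivAt_sin x)) using 1
    norm_num
    ring
  have d4 : deriv (fun x => -6 * (Real.sin x * Real.cos x) - 2 * (Real.sin x - y) * Real.cos x)
      = fun x => -8 * Real.cos x ^ 2 + 6 * Real.sin x ^ 2
        + 2 * (Real.sin x - y) * Real.sin x := by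
    funext x
    apply HasDerivAt.deriv
    convert (((Real.hasDerivAt_sin x).fun_mul (Real.hasDerivAt_cos x)).const_mul (-6)).fun_sub
      ((((Real.hasDerivAt_sin x).sub_const y).const_mul 2).fun_mul
      (Real.hasDerivAt_cos x)) using 1
    ring
  have e2 : iteratedDeriv 2 (fun x => (Real.sin x - y) ^ 2)
      = fun x => 2 * Real.cos x ^ 2 - 2 * (Real.sin x - y) * Real.sin x := by
    rw [iteratedDeriv_succ, iteratedDeriv_one, d1, d2]
  have e3 : iteratedDeriv 3 (fun x => (Real.sin x - y) ^ 2)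
      = fun x => -6 * (Real.sin x * Real.cos x) - 2 * (Real.sin x - y) * Real.cos x := by
    rw [iteratedDeriv_succ, e2, d3]
  have e4 : iteratedDeriv 4 (fun x => (Real.sin x - y) ^ 2)
      = fun x => -8 * Real.cos x ^ 2 + 6 * Real.sin x ^ 2
        + 2 * (Real.sin x - y) * Real.sin x := by
    rw [iteratedDeriv_succ, e3, d4]
  have hc : 0 < Real.cos xbar := Real.cos_pos_of_mem_Ioo hx
  rw [d1, e2, e3, e4]
  simp only [hsin, sub_self, mul_zero, zero_mul, sub_zero, add_zero]
  refine ⟨trivial, trivial, by positivity, fun h => ⟨?_, ?_⟩, fun h => ⟨?_, ?_⟩⟩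
  · exact mul_ne_zero (by norm_num) (mul_ne_zero h hc.ne')
  · have : 0 < 96 * (y ^ 2 * Real.cos xbar ^ 2) + 16 * Real.cos xbar ^ 4 := by positivity
    nlinarith
  · simp [h]
  · have : 0 < Real.cos xbar ^ 2 := by positivity
    rw [h]
    linarith
end

section
/- Let y ∈ (−1, 1), let x̄ ∈ ℝ with tanh(x̄) = y, and define f(x) = (tanh(x) − y)². Then f'(x̄) = 0 and f''(x̄) = 2·sech⁴(x̄) > 0; moreover, if y ≠ 0 then f'''(x̄) ≠ 0 and 3·f'''(x̄)² − f''(x̄)·f⁽⁴⁾(x̄) > 0, while if y = 0 then f'''(x̄) = 0 and f⁽⁴⁾(x̄) < 0. -/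
open Real

lemma hasDerivAt_tanh_aux (x : ℝ) : HasDerivAt Real.tanh (1 - Real.tanh x ^ 2) x := by
  have hc : Real.cosh x ≠ 0 := (Real.cosh_pos x).ne'
  have h := (Real.hasDerivAt_sinh x).div (Real.hasDerivAt_cosh x) hc
  have e : Real.tanh = Real.sinh / Real.cosh := by
    funext z
    simp [Real.tanh_eq_sinh_div_cosh]
  have e2 : 1 - Real.tanh x ^ 2 =
      (Real.cosh x * Real.cosh x - Real.sinh x * Real.sinh x) / Real.cosh x ^ 2 := by
    rw [Real.tanh_eq_sinh_div_cosh]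
    field_simp
  rw [e2, e]
  exact h

open Polynomial in
lemma deriv_poly_tanh_aux (p : ℝ[X]) :
    deriv (fun x => p.eval (Real.tanh x)) =
      fun x => ((1 - X ^ 2) * derivative p).eval (Real.tanh x) := by
  funext x
  have h := (p.hasDerivAt (Real.tanh x)).comp x (hasDerivAt_tanh_aux x)
  refine h.deriv.trans ?_
  simp [mul_comm]

open Polynomial in
lemma tanh_derivs_aux (y : ℝ) :
    (deriv (fun x => (Real.tanh x - y) ^ 2) =
      fun x => 2 * (Real.tanh x - y) * (1 - Real.tanh x ^ 2)) ∧
    (iteratedDeriv 2 (fun x => (Real.tanh x - y) ^ 2) =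
      fun x => 2 * (1 - Real.tanh x ^ 2) * (1 - 3 * Real.tanh x ^ 2 + 2 * y * Real.tanh x)) ∧
    (iteratedDeriv 3 (fun x => (Real.tanh x - y) ^ 2) =
      fun x => 2 * (1 - Real.tanh x ^ 2) *
        (12 * Real.tanh x ^ 3 - 6 * y * Real.tanh x ^ 2 - 8 * Real.tanh x + 2 * y)) ∧
    (iteratedDeriv 4 (fun x => (Real.tanh x - y) ^ 2) =
      fun x => 2 * (1 - Real.tanh x ^ 2) *
        (-2 * Real.tanh x *
          (12 * Real.tanh x ^ 3 - 6 * y * Real.tanh x ^ 2 - 8 * Real.tanh x + 2 * y) +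
        (1 - Real.tanh x ^ 2) * (36 * Real.tanh x ^ 2 - 12 * y * Real.tanh x - 8))) := by
  have e0 : (fun x => (Real.tanh x - y) ^ 2) =
      fun x => ((X - C y) ^ 2 : ℝ[X]).eval (Real.tanh x) := by
    funext x; simp
  have h1 : deriv (fun x => (Real.tanh x - y) ^ 2) =
      fun x => (C 2 * (X - C y) * (1 - X ^ 2) : ℝ[X]).eval (Real.tanh x) := by
    rw [e0, deriv_poly_tanh_aux]
    funext x; simp [derivative_pow]; ring
  have h2 : iteratedDeriv 2 (fun x => (Real.tanh x - y) ^ 2) =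
      fun x => (C 2 * (1 - X ^ 2) * (1 - C 3 * X ^ 2 + C (2 * y) * X) : ℝ[X]).eval
        (Real.tanh x) := by
    rw [iteratedDeriv_succ, iteratedDeriv_one, h1, deriv_poly_tanh_aux]
    funext x; simp [derivative_pow]; ring
  have h3 : iteratedDeriv 3 (fun x => (Real.tanh x - y) ^ 2) =
      fun x => (C 2 * (1 - X ^ 2) *
        (C 12 * X ^ 3 - C (6 * y) * X ^ 2 - C 8 * X + C (2 * y)) : ℝ[X]).eval
        (Real.tanh x) := by
    rw [iteratedDeriv_succ, h2, deriv_poly_tanh_aux]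
    funext x; simp [derivative_pow]; ring
  refine ⟨?_, ?_, ?_, ?_⟩
  · rw [h1]; funext x; simp
  · rw [h2]; funext x; simp
  · rw [h3]; funext x; simp
  · rw [iteratedDeriv_succ, h3, deriv_poly_tanh_aux]
    funext x; simp [derivative_pow]; ring

/-- For `f(x) = (tanh x − y)²` with `y ∈ (−1,1)` and `tanh x̄ = y`:
`f'(x̄) = 0`, `f''(x̄) = 2 sech⁴ x̄ > 0` (where `sech = 1/cosh`); if `y ≠ 0` then
`f'''(x̄) ≠ 0` and `3 f'''(x̄)² − f''(x̄) f⁗(x̄) > 0`, while if `y = 0` then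
`f'''(x̄) = 0` and `f⁗(x̄) < 0`. -/
theorem tanh_squared_loss_oscillation_condition
    (y xbar : ℝ) (hy : y ∈ Set.Ioo (-1 : ℝ) 1)
    (htanh : Real.tanh xbar = y) :
    deriv (fun x => (Real.tanh x - y) ^ 2) xbar = 0 ∧
    iteratedDeriv 2 (fun x => (Real.tanh x - y) ^ 2) xbar
      = 2 * (1 / Real.cosh xbar) ^ 4 ∧
    0 < iteratedDeriv 2 (fun x => (Real.tanh x - y) ^ 2) xbar ∧
    (y ≠ 0 →
      iteratedDeriv 3 (fun x => (Real.tanh x - y) ^ 2) xbar ≠ 0 ∧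
      0 < 3 * (iteratedDeriv 3 (fun x => (Real.tanh x - y) ^ 2) xbar) ^ 2
        - iteratedDeriv 2 (fun x => (Real.tanh x - y) ^ 2) xbar
          * iteratedDeriv 4 (fun x => (Real.tanh x - y) ^ 2) xbar) ∧
    (y = 0 →
      iteratedDeriv 3 (fun x => (Real.tanh x - y) ^ 2) xbar = 0 ∧
      iteratedDeriv 4 (fun x => (Real.tanh x - y) ^ 2) xbar < 0) := by
  obtain ⟨h1, h2, h3, h4⟩ := tanh_derivs_aux y
  have hs : 0 < 1 - y ^ 2 := by nlinarith [hy.1, hy.2]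
  have hc : (1 / Real.cosh xbar) ^ 2 = 1 - y ^ 2 := by
    have := (Real.cosh_pos xbar).ne'
    have h := Real.cosh_sq xbar
    rw [← htanh, Real.tanh_eq_sinh_div_cosh]
    field_simp
    linarith
  have hc4 : (1 / Real.cosh xbar) ^ 4 = (1 - y ^ 2) ^ 2 := by
    rw [← hc]; ring
  have v2 : iteratedDeriv 2 (fun x => (Real.tanh x - y) ^ 2) xbar = 2 * (1 - y ^ 2) ^ 2 := by
    rw [h2]; simp only [htanh]; ring
  have v3 : iteratedDeriv 3 (fun x => (Real.tanh x - y) ^ 2) xbar =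
      -12 * y * (1 - y ^ 2) ^ 2 := by
    rw [h3]; simp only [htanh]; ring
  have v4 : iteratedDeriv 4 (fun x => (Real.tanh x - y) ^ 2) xbar =
      2 * (1 - y ^ 2) ^ 2 * (36 * y ^ 2 - 8) := by
    rw [h4]; simp only [htanh]; ring
  rw [v2, v3, v4, hc4, h1]
  refine ⟨by simp [htanh], rfl, by positivity, fun h => ⟨?_, ?_⟩, fun h => ?_⟩
  · exact mul_ne_zero (mul_ne_zero (by norm_num) h) (by positivity)
  · have : 0 < (1 - y ^ 2) ^ 4 * (288 * y ^ 2 + 32) := by positivity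
    linarith
  · rw [h]
    norm_num
end

section
/- Let μ > 0, f(x) = (1/4)(x² − μ)², and η = K/μ with 1 < K ≤ 1.121, and set F(x) = x − η·f'(x) = x + η·(μ − x²)·x. There exists a unique pair (x̄₀, x̄₁) with 0 < x̄₀ < √μ < x̄₁, F(x̄₀) = x̄₁ and F(x̄₁) = x̄₀ (a period-2 orbit), and each x ∈ {x̄₀, x̄₁} satisfies η = 1/(x²·(√(μ/x² − 3/4) + 1/2)). Moreover, for every initial point x₀ ∈ (0, √μ): either the iterates Fᵗ(x₀) converge to √μ, or the even iterates F^{2t}(x₀) converge to one of x̄₀, x̄₁ and the odd iterates F^{2t+1}(x₀) converge to the other; and the set of initial points x₀ ∈ (0, √μ) whose iterates converge to √μ has Lebesgue measure zero. -/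
open Filter

/-- One step of gradient descent on `f(x) = (1/4)(x² − μ)²` with step size `η`:
`F(x) = x − η f'(x) = x + η (μ − x²) x`. -/
noncomputable def gdMap (η μ x : ℝ) : ℝ := x + η * (μ - x ^ 2) * x

theorem gd_conv_up (h : ℝ → ℝ) (hc : Continuous h) (a b : ℝ)
    (hm : ∀ x, a ≤ x → x ≤ b → x ≤ h x ∧ h x ≤ b) (w : ℝ) (hw : a ≤ w) (hwb : w ≤ b) :
    ∃ L, w ≤ L ∧ L ≤ b ∧ h L = L ∧ Tendsto (fun t => h^[t] w) atTop (nhds L) := by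
  have hin : ∀ t, a ≤ h^[t] w ∧ h^[t] w ≤ b := by
    intro t
    induction t with
    | zero => exact ⟨hw, hwb⟩
    | succ n ih =>
      rw [Function.iterate_succ_apply']
      obtain ⟨h1, h2⟩ := hm _ ih.1 ih.2
      exact ⟨ih.1.trans h1, h2⟩
  have hmono : Monotone (fun t => h^[t] w) := by
    apply monotone_nat_of_le_succ
    intro n
    simp only [Function.iterate_succ_apply']
    exact (hm _ (hin n).1 (hin n).2).1
  have hbdd : BddAbove (Set.range (fun t => h^[t] w)) := by
    refine ⟨b, ?_⟩
    rintro _ ⟨t, rfl⟩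
    exact (hin t).2
  have ht := tendsto_atTop_ciSup hmono hbdd
  set L := ⨆ t, h^[t] w with hL
  refine ⟨L, ?_, ?_, ?_, ht⟩
  · exact le_ciSup hbdd 0
  · exact ciSup_le fun t => (hin t).2
  · exact isFixedPt_of_tendsto_iterate ht hc.continuousAt

theorem gd_conv_down (h : ℝ → ℝ) (hc : Continuous h) (a b : ℝ)
    (hm : ∀ x, a ≤ x → x ≤ b → h x ≤ x ∧ a ≤ h x) (w : ℝ) (hw : a ≤ w) (hwb : w ≤ b) :
    ∃ L, L ≤ w ∧ a ≤ L ∧ h L = L ∧ Tendsto (fun t => h^[t] w) atTop (nhds L) := by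
  have hin : ∀ t, a ≤ h^[t] w ∧ h^[t] w ≤ b := by
    intro t
    induction t with
    | zero => exact ⟨hw, hwb⟩
    | succ n ih =>
      rw [Function.iterate_succ_apply']
      obtain ⟨h1, h2⟩ := hm _ ih.1 ih.2
      exact ⟨h2, h1.trans ih.2⟩
  have hmono : Antitone (fun t => h^[t] w) := by
    apply antitone_nat_of_succ_le
    intro n
    simp only [Function.iterate_succ_apply']
    exact (hm _ (hin n).1 (hin n).2).1
  have hbdd : BddBelow (Set.range (fun t => h^[t] w)) := by
    refine ⟨a, ?_⟩
    rintro _ ⟨t, rfl⟩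
    exact (hin t).1
  have ht := tendsto_atTop_ciInf hmono hbdd
  set L := ⨅ t, h^[t] w with hL
  refine ⟨L, ?_, ?_, ?_, ht⟩
  · exact ciInf_le hbdd 0
  · exact le_ciInf fun t => (hin t).1
  · exact isFixedPt_of_tendsto_iterate ht hc.continuousAt

theorem gd_continuous (η μ : ℝ) : Continuous (gdMap η μ) := by
  unfold gdMap; fun_prop

/-- Convergence of even and odd iterates to the two-cycle. -/
def gdCyc (g : ℝ → ℝ) (x0 x1 z : ℝ) : Prop :=
  (Tendsto (fun t => g^[2 * t] z) atTop (nhds x0) ∧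
    Tendsto (fun t => g^[2 * t + 1] z) atTop (nhds x1)) ∨
  (Tendsto (fun t => g^[2 * t] z) atTop (nhds x1) ∧
    Tendsto (fun t => g^[2 * t + 1] z) atTop (nhds x0))

theorem gdCyc_step (g : ℝ → ℝ) (x0 x1 z : ℝ) (h : gdCyc g x0 x1 (g z)) : gdCyc g x0 x1 z := by
  have key : ∀ a b, Tendsto (fun t => g^[2 * t] (g z)) atTop (nhds a) →
      Tendsto (fun t => g^[2 * t + 1] (g z)) atTop (nhds b) →
      Tendsto (fun t => g^[2 * t] z) atTop (nhds b) ∧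
      Tendsto (fun t => g^[2 * t + 1] z) atTop (nhds a) := by
    intro a b ha hb
    constructor
    · rw [← tendsto_add_atTop_iff_nat 1]
      exact hb
    · exact ha
  rcases h with ⟨h1, h2⟩ | ⟨h1, h2⟩
  · exact Or.inr (key _ _ h1 h2)
  · exact Or.inl (key _ _ h1 h2)

theorem gdCyc_iter (g : ℝ → ℝ) (x0 x1 : ℝ) (n : ℕ) : ∀ z, gdCyc g x0 x1 (g^[n] z) →
    gdCyc g x0 x1 z := by
  induction n with
  | zero => intro z h; exact h
  | succ n ih => intro z h; exact gdCyc_step _ _ _ _ (ih _ h)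

theorem gd_sq_sub (K y : ℝ) : gdMap K 1 (gdMap K 1 y) - y =
    K * y * (1 - y ^ 2) * (K + 2 - K * y ^ 2) *
      (K ^ 2 * (y ^ 2) ^ 2 - K * (K + 1) * y ^ 2 + 1) := by
  unfold gdMap; ring

theorem gd_sub (K x y : ℝ) : gdMap K 1 x - gdMap K 1 y =
    (x - y) * (1 + K - K * (x ^ 2 + x * y + y ^ 2)) := by
  unfold gdMap; ring

theorem gd_anti (K c x y : ℝ) (hK : 0 < K) (hc0 : 0 < c) (hc2 : 3 * K * c ^ 2 = 1 + K)
    (hx : c ≤ x) (hy : x < y) : gdMap K 1 y < gdMap K 1 x := by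
  have h := gd_sub K y x
  have h1 : c ^ 2 ≤ x ^ 2 := pow_le_pow_left₀ hc0.le hx 2
  have h2 : c ^ 2 < y ^ 2 := pow_lt_pow_left₀ (by linarith) hc0.le (by norm_num)
  have h3 : c * c ≤ y * x := mul_le_mul (by linarith) hx hc0.le (by linarith)
  have h4 : K * (3 * c ^ 2) < K * (y ^ 2 + y * x + x ^ 2) :=
    mul_lt_mul_of_pos_left (by nlinarith) hK
  have h5 : 1 + K - K * (y ^ 2 + y * x + x ^ 2) < 0 := by linarith
  have := mul_neg_of_pos_of_neg (sub_pos.2 hy) h5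
  linarith

/-- Facts about the normalised problem `μ = 1`. -/
theorem gd_norm_cycle (K : ℝ) (hK1 : 1 < K) (hK2 : K ≤ 1.121) :
    ∃ x0 x1 : ℝ, 0 < x0 ∧ x0 < 1 ∧ 1 < x1 ∧ x0 * x1 = 1 / K ∧ x0 ^ 2 + x1 ^ 2 = 1 + 1 / K := by
  have hK0 : 0 < K := by linarith
  have h1 : 0 < 1 - 1 / K := by
    have : 1 / K < 1 := by rw [div_lt_one hK0]; exact hK1
    linarith
  have hk : 0 < 1 / K := by positivity
  have hp2 := Real.sq_sqrt (show 0 ≤ 1 + 3 * (1 / K) by linarith)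
  have hd2 := Real.sq_sqrt h1.le
  have hp0 := Real.sqrt_nonneg (1 + 3 * (1 / K))
  have hd0 := Real.sqrt_pos.2 h1
  set p := Real.sqrt (1 + 3 * (1 / K))
  set d := Real.sqrt (1 - 1 / K)
  set k := 1 / K with hkd
  have hk1 : k < 1 := by linarith
  have hprod : (p - d) / 2 * ((p + d) / 2) = k := by nlinarith
  have hsum : ((p - d) / 2) ^ 2 + ((p + d) / 2) ^ 2 = 1 + k := by nlinarith
  have hx1 : 0 < (p + d) / 2 := by linarith
  have hx0 : 0 < (p - d) / 2 := by
    by_contra h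
    nlinarith
  have hlt : (p - d) / 2 < (p + d) / 2 := by linarith
  refine ⟨(p - d) / 2, (p + d) / 2, hx0, ?_, ?_, hprod, hsum⟩
  all_goals
    generalize (p - d) / 2 = x at *
    generalize (p + d) / 2 = y at *
  -- (1 - x²)(1 - y²) = 1 - (1 + k) + k² = k (k - 1) < 0
  · have : (1 - x ^ 2) * (1 - y ^ 2) < 0 := by
      have : (1 - x ^ 2) * (1 - y ^ 2) = 1 - (1 + k) + k ^ 2 := by
        rw [← hsum, ← hprod]; ring
      rw [this]; nlinarith
    by_contra h
    have h2 : 1 ≤ x := not_lt.1 h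
    have h3 : 1 ≤ y := by linarith
    nlinarith [mul_nonneg (show 0 ≤ x ^ 2 - 1 by nlinarith) (show 0 ≤ y ^ 2 - 1 by nlinarith)]
  · have : (1 - x ^ 2) * (1 - y ^ 2) < 0 := by
      have : (1 - x ^ 2) * (1 - y ^ 2) = 1 - (1 + k) + k ^ 2 := by
        rw [← hsum, ← hprod]; ring
      rw [this]; nlinarith
    by_contra h
    have h2 : y ≤ 1 := not_lt.1 h
    have h3 : x ≤ 1 := by linarith
    nlinarith [mul_nonneg (show 0 ≤ 1 - x ^ 2 by nlinarith) (show 0 ≤ 1 - y ^ 2 by nlinarith)]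

theorem gd_norm_orbit (K x0 x1 : ℝ) (hK : 0 < K) (hp : x0 * x1 = 1 / K)
    (hs : x0 ^ 2 + x1 ^ 2 = 1 + 1 / K) : gdMap K 1 x0 = x1 := by
  have hp' : K * (x0 * x1) = 1 := by rw [hp]; field_simp
  have hs' : K * (x0 ^ 2 + x1 ^ 2) = K + 1 := by rw [hs]; field_simp
  unfold gdMap
  linear_combination x1 * hp' - x0 * hs'

theorem gd_norm_unique (K a b : ℝ) (hK : 0 < K) (ha : 0 < a) (hab : a < b)
    (h1 : gdMap K 1 a = b) (h2 : gdMap K 1 b = a) :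
    a * b = 1 / K ∧ a ^ 2 + b ^ 2 = 1 + 1 / K := by
  unfold gdMap at h1 h2
  have e1 : K * (a ^ 2 + a * b + b ^ 2) = K + 2 := by
    have : (b - a) * (K * (a ^ 2 + a * b + b ^ 2) - (K + 2)) = 0 := by
      linear_combination h1 - h2
    rcases mul_eq_zero.1 this with h | h <;> linarith
  have e2 : K * (a ^ 2 - a * b + b ^ 2) = K := by
    have : (a + b) * (K * (a ^ 2 - a * b + b ^ 2) - K) = 0 := by
      linear_combination -h1 - h2
    rcases mul_eq_zero.1 this with h | h <;> linarith
  constructor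
  · rw [eq_div_iff hK.ne']; linarith
  · field_simp; linarith

theorem gd_norm_pair (x0 x1 a b : ℝ) (h0 : 0 < x0) (h01 : x0 < x1) (ha : 0 < a) (hab : a < b)
    (hp : a * b = x0 * x1) (hs : a ^ 2 + b ^ 2 = x0 ^ 2 + x1 ^ 2) : a = x0 ∧ b = x1 := by
  have h1 : a + b = x0 + x1 := by
    rw [← sq_eq_sq₀ (by linarith) (by linarith)]; linarith
  have h2 : b - a = x1 - x0 := by
    rw [← sq_eq_sq₀ (by linarith) (by linarith)]; linarith
  constructor <;> linarith

theorem gd_norm_form (K x0 x1 : ℝ) (hK : 0 < K) (hx0 : 0 < x0) (hK2 : K ≤ 1.121)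
    (hp : x0 * x1 = 1 / K)
    (hs : x0 ^ 2 + x1 ^ 2 = 1 + 1 / K) :
    K * (x0 ^ 2 * (Real.sqrt (1 / x0 ^ 2 - 3 / 4) + 1 / 2)) = 1 := by
  have hp' : K * (x0 * x1) = 1 := by rw [hp]; field_simp
  have hs' : K * (x0 ^ 2 + x1 ^ 2) = K + 1 := by rw [hs]; field_simp
  have hq : K ^ 2 * (x0 ^ 2) ^ 2 - K * (K + 1) * x0 ^ 2 + 1 = 0 := by
    linear_combination K * x0 ^ 2 * hs' - (K * (x0 * x1) + 1) * hp'
  have hu : 0 < x0 ^ 2 := by positivity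
  have : Real.sqrt (1 / x0 ^ 2 - 3 / 4) = 1 / (K * x0 ^ 2) - 1 / 2 := by
    rw [Real.sqrt_eq_iff_mul_self_eq_of_pos]
    · generalize x0 ^ 2 = u at *
      field_simp
      linear_combination 16 * hq
    · generalize x0 ^ 2 = u at *
      rw [sub_pos, div_lt_div_iff₀ (by norm_num) (by positivity)]
      by_contra h
      norm_num at hK2
      have h2 : 0 ≤ K * u - 2 := by linarith [not_lt.1 h]
      nlinarith [mul_nonneg (show 0 ≤ 3 - K by linarith) h2, sq_nonneg (K * u - 2)]
  rw [this]
  field_simp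
  ring

set_option maxHeartbeats 1000000 in
theorem gd_norm_main (K x0 x1 : ℝ) (hK1 : 1 < K) (hK2 : K ≤ 1.121)
    (h0 : 0 < x0) (h01 : x0 < 1) (h11 : 1 < x1) (hp : x0 * x1 = 1 / K)
    (hs : x0 ^ 2 + x1 ^ 2 = 1 + 1 / K) (z : ℝ) (hz0 : 0 < z) (hz1 : z < 1) :
    (∃ n, (gdMap K 1)^[n] z = 1) ∨ gdCyc (gdMap K 1) x0 x1 z := by
  have hK : 0 < K := by linarith
  have o0 : gdMap K 1 x0 = x1 := gd_norm_orbit K x0 x1 hK hp hs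
  have o1 : gdMap K 1 x1 = x0 :=
    gd_norm_orbit K x1 x0 hK (by rw [← hp]; ring) (by rw [← hs]; ring)
  have hp' : K * (x0 * x1) = 1 := by rw [hp]; field_simp
  have hs' : K * (x0 ^ 2 + x1 ^ 2) = K + 1 := by rw [hs]; field_simp
  have hquad : ∀ u : ℝ, K ^ 2 * u ^ 2 - K * (K + 1) * u + 1 =
      K ^ 2 * (x0 ^ 2 - u) * (x1 ^ 2 - u) := by
    intro u
    linear_combination K * u * hs' - (K * (x0 * x1) + 1) * hp'
  have hgc := gd_continuous K 1
  have hsgn : ∀ y : ℝ, 0 < y → y < 1 → ∃ q > 0,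
      gdMap K 1 (gdMap K 1 y) - y = q * (x0 - y) := by
    intro y hy0 hy1
    refine ⟨K * y * (1 - y ^ 2) * (K + 2 - K * y ^ 2) * (K ^ 2 * (x0 + y) * (x1 ^ 2 - y ^ 2)),
      ?_, ?_⟩
    · have a1 : 0 < 1 - y ^ 2 := by nlinarith
      have a2 : 0 < K + 2 - K * y ^ 2 := by nlinarith
      have a3 : 0 < x1 ^ 2 - y ^ 2 := by nlinarith
      positivity
    · rw [gd_sq_sub, hquad]; ring
  have hg1 : gdMap K 1 1 = 1 := by unfold gdMap; ring
  -- critical point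
  obtain ⟨c, hc0, hc2⟩ : ∃ c : ℝ, 0 < c ∧ 3 * K * c ^ 2 = 1 + K := by
    refine ⟨Real.sqrt ((1 + K) / (3 * K)), Real.sqrt_pos.2 (by positivity), ?_⟩
    rw [Real.sq_sqrt (by positivity)]; field_simp
  have hcx : c < x0 := by
    have hq := hquad (c ^ 2)
    have e : K ^ 2 * (c ^ 2) ^ 2 - K * (K + 1) * c ^ 2 + 1 = 1 - 2 * (1 + K) ^ 2 / 9 := by
      linear_combination (K * c ^ 2 / 3 + (1 + K) / 9 - (1 + K) / 3) * hc2
    have e2 : 0 < 1 - 2 * (1 + K) ^ 2 / 9 := by norm_num at hK2; nlinarith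
    rw [e] at hq
    have hc1 : c ^ 2 < x1 ^ 2 := by
      have : 1 < x1 ^ 2 := by nlinarith
      have : c ^ 2 < 1 := by by_contra h; nlinarith
      linarith
    have : 0 < x0 ^ 2 - c ^ 2 := by
      by_contra h
      have : K ^ 2 * (x0 ^ 2 - c ^ 2) * (x1 ^ 2 - c ^ 2) ≤ 0 := by
        apply mul_nonpos_of_nonpos_of_nonneg
        · exact mul_nonpos_of_nonneg_of_nonpos (by positivity) (not_lt.1 h)
        · linarith
      linarith
    nlinarith
  have hc1 : c < 1 := by linarith
  have hantis : ∀ x y, c ≤ x → x < y → gdMap K 1 y < gdMap K 1 x :=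
    fun x y hx hy => gd_anti K c x y hK hc0 hc2 hx hy
  have hanti : ∀ x y, c ≤ x → x ≤ y → gdMap K 1 y ≤ gdMap K 1 x := by
    intro x y hx hy
    rcases hy.eq_or_lt with h | h
    · rw [h]
    · exact (hantis x y hx h).le
  have hmax : ∀ x, 0 ≤ x → gdMap K 1 x ≤ gdMap K 1 c := by
    intro x hx
    have : gdMap K 1 c - gdMap K 1 x = K * (x - c) ^ 2 * (x + 2 * c) := by
      unfold gdMap
      linear_combination (x - c) * hc2
    have h2 : 0 ≤ K * (x - c) ^ 2 * (x + 2 * c) := by positivity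
    linarith
  have hcc : c < gdMap K 1 (gdMap K 1 c) := by
    obtain ⟨q, hq, e⟩ := hsgn c hc0 hc1
    have := mul_pos hq (sub_pos.2 hcx)
    linarith
  -- monotonicity of the square on [c, 1]
  have hge1 : ∀ x, c ≤ x → x ≤ 1 → 1 ≤ gdMap K 1 x := by
    intro x hx hx1
    have := hanti x 1 hx hx1
    rwa [hg1] at this
  have hh : ∀ x y, c ≤ x → x ≤ y → y ≤ 1 →
      gdMap K 1 (gdMap K 1 x) ≤ gdMap K 1 (gdMap K 1 y) := by
    intro x y hx hxy hy
    exact hanti _ _ (by linarith [hge1 y (hx.trans hxy) hy]) (hanti x y hx hxy)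
  have hcont2 : Continuous (fun y => gdMap K 1 (gdMap K 1 y)) := hgc.comp hgc
  have hiter : ∀ w t, (fun y => gdMap K 1 (gdMap K 1 y))^[t] w = (gdMap K 1)^[2 * t] w := by
    intro w t
    rw [Function.iterate_mul]
    rfl
  have hoo : gdMap K 1 (gdMap K 1 x0) = x0 := by rw [o0, o1]
  -- left half
  have hleft : ∀ w, c ≤ w → w < 1 → gdCyc (gdMap K 1) x0 x1 w := by
    intro w hw hw1
    have ht : Tendsto (fun t => (gdMap K 1)^[2 * t] w) atTop (nhds x0) := by
      simp only [← hiter]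
      have hfix : ∀ L, 0 < L → L < 1 → gdMap K 1 (gdMap K 1 L) = L → L = x0 := by
        intro L hL hL1 hf
        obtain ⟨q, hq, e⟩ := hsgn L hL hL1
        rw [hf, sub_self] at e
        rcases mul_eq_zero.1 e.symm with h | h <;> linarith
      rcases le_total w x0 with hwx | hwx
      · obtain ⟨L, h1, h2, h3, h4⟩ := gd_conv_up _ hcont2 c x0 (by
          intro x hx hx0
          obtain ⟨q, hq, e⟩ := hsgn x (by linarith) (by linarith)
          constructor
          · have := mul_nonneg hq.le (sub_nonneg.2 hx0)
            linarith
          · have := hh x x0 hx hx0 h01.le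
            rwa [hoo] at this) w hw hwx
        rwa [hfix L (by linarith) (by linarith) h3] at h4
      · obtain ⟨L, h1, h2, h3, h4⟩ := gd_conv_down _ hcont2 x0 w (by
          intro x hx hx0
          obtain ⟨q, hq, e⟩ := hsgn x (by linarith) (by linarith)
          constructor
          · have := mul_nonneg hq.le (sub_nonneg.2 hx)
            linarith
          · have := hh x0 x hcx.le hx (by linarith)
            rwa [hoo] at this) w hwx le_rfl
        rwa [hfix L (by linarith) (by linarith) h3] at h4
    refine Or.inl ⟨ht, ?_⟩
    simp only [Function.iterate_succ_apply']
    have := (hgc.tendsto x0).comp ht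
    rw [o0] at this
    exact this
  have hJ : ∀ w, c ≤ w → w ≤ gdMap K 1 c → w = 1 ∨ gdCyc (gdMap K 1) x0 x1 w := by
    intro w hw hw2
    rcases lt_trichotomy w 1 with h | h | h
    · exact Or.inr (hleft w hw h)
    · exact Or.inl h
    · right
      apply gdCyc_step
      apply hleft
      · exact hcc.le.trans (hanti _ _ hw hw2)
      · have := hantis 1 w hc1.le h
        rwa [hg1] at this
  -- entrance
  have hent : ∃ n, c ≤ (gdMap K 1)^[n] z ∧ (gdMap K 1)^[n] z ≤ gdMap K 1 c := by
    by_cases hzc : c ≤ z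
    · refine ⟨0, hzc, ?_⟩
      have := hge1 c le_rfl hc1.le
      simp only [Function.iterate_zero, id]
      linarith
    have hinc : ∀ x, 0 < x → x < 1 → x < gdMap K 1 x := by
      intro x hx hx1
      have : gdMap K 1 x - x = K * x * (1 - x ^ 2) := by unfold gdMap; ring
      have h2 : 0 < 1 - x ^ 2 := by nlinarith
      have : 0 < K * x * (1 - x ^ 2) := by positivity
      linarith
    by_contra hno
    push Not at hno
    have hall : ∀ n, 0 < (gdMap K 1)^[n] z ∧ (gdMap K 1)^[n] z < c := by
      intro n
      induction n with
      | zero => exact ⟨hz0, not_le.1 hzc⟩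
      | succ n ih =>
        have i1 := hinc _ ih.1 (by linarith [ih.2])
        have i2 := hmax _ ih.1.le
        have i3 := hno (n + 1)
        rw [Function.iterate_succ_apply'] at i3 ⊢
        refine ⟨by linarith [ih.1], ?_⟩
        by_contra h
        linarith [i3 (not_lt.1 h)]
    have hmono : Monotone (fun t => (gdMap K 1)^[t] z) := by
      apply monotone_nat_of_le_succ
      intro n
      simp only [Function.iterate_succ_apply']
      exact (hinc _ (hall n).1 (by linarith [(hall n).2])).le
    have hbdd : BddAbove (Set.range (fun t => (gdMap K 1)^[t] z)) := by
      refine ⟨c, ?_⟩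
      rintro _ ⟨t, rfl⟩
      exact (hall t).2.le
    have ht := tendsto_atTop_ciSup hmono hbdd
    have hf : gdMap K 1 _ = _ := isFixedPt_of_tendsto_iterate ht hgc.continuousAt
    have l1 : z ≤ ⨆ t, (gdMap K 1)^[t] z := le_ciSup hbdd 0
    have l2 : (⨆ t, (gdMap K 1)^[t] z) ≤ c := ciSup_le fun t => (hall t).2.le
    have := hinc _ (by linarith) (by linarith : (⨆ t, (gdMap K 1)^[t] z) < 1)
    linarith
  obtain ⟨n, hn1, hn2⟩ := hent
  rcases hJ _ hn1 hn2 with h | h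
  · exact Or.inl ⟨n, h⟩
  · exact Or.inr (gdCyc_iter _ _ _ n _ h)

theorem gd_fiber_finite (η μ w : ℝ) (hη : η ≠ 0) : {x : ℝ | gdMap η μ x = w}.Finite := by
  let p : Polynomial ℝ := Polynomial.C (-η) * Polynomial.X ^ 3 +
    Polynomial.C (1 + η * μ) * Polynomial.X - Polynomial.C w
  have hp : p ≠ 0 := by
    intro h
    have : p.coeff 3 = 0 := by rw [h]; simp
    simp [p, Polynomial.coeff_one] at this
    exact hη this
  apply (p.rootSet_finite ℝ).subset
  intro x hx
  have hx' : gdMap η μ x = w := hx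
  rw [Polynomial.mem_rootSet]
  refine ⟨hp, ?_⟩
  simp [p]
  rw [← hx']
  unfold gdMap
  ring

theorem gd_countable (η μ w : ℝ) (hη : η ≠ 0) :
    {x : ℝ | ∃ n, (gdMap η μ)^[n] x = w}.Countable := by
  have : ∀ n : ℕ, {x : ℝ | (gdMap η μ)^[n] x = w}.Countable := by
    intro n
    induction n with
    | zero => exact (Set.countable_singleton w).mono (by intro x hx; simpa using hx)
    | succ n ih =>
      apply (ih.biUnion (fun v _ => (gd_fiber_finite η μ v hη).countable)).mono
      intro x hx
      simp only [Set.mem_iUnion, Set.mem_ofPred_eq]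
      exact ⟨gdMap η μ x, hx, rfl⟩
  apply (Set.countable_iUnion this).mono
  rintro x ⟨n, hn⟩
  exact Set.mem_iUnion.2 ⟨n, hn⟩

/-- For `f(x) = (1/4)(x² − μ)²`, `μ > 0`, and step size `η = K/μ` with
`1 < K ≤ 1.121`, there is a unique period-2 orbit `(x̄₀, x̄₁)` with
`0 < x̄₀ < √μ < x̄₁`; each orbit point satisfies the closed-form equation
`η = 1/(x² (√(μ/x² − 3/4) + 1/2))`; every trajectory started in `(0, √μ)` either
converges to `√μ` or converges (along even/odd iterates) to the period-2 orbit; and the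
set of initial points converging to `√μ` has Lebesgue measure zero. -/
theorem one_dim_global_convergence_period_two
    (μ K η : ℝ) (hμ : 0 < μ) (hK1 : 1 < K) (hK2 : K ≤ 1.121) (hη : η = K / μ) :
    ∃ x0 x1 : ℝ,
      (0 < x0 ∧ x0 < Real.sqrt μ ∧ Real.sqrt μ < x1 ∧
        gdMap η μ x0 = x1 ∧ gdMap η μ x1 = x0) ∧
      (∀ a b : ℝ, 0 < a → a < Real.sqrt μ → Real.sqrt μ < b →
        gdMap η μ a = b → gdMap η μ b = a → a = x0 ∧ b = x1) ∧
      (∀ x ∈ ({x0, x1} : Set ℝ),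
        η = 1 / (x ^ 2 * (Real.sqrt (μ / x ^ 2 - 3 / 4) + 1 / 2))) ∧
      (∀ z ∈ Set.Ioo (0 : ℝ) (Real.sqrt μ),
        Tendsto (fun t => (gdMap η μ)^[t] z) atTop (nhds (Real.sqrt μ)) ∨
        (Tendsto (fun t => (gdMap η μ)^[2 * t] z) atTop (nhds x0) ∧
          Tendsto (fun t => (gdMap η μ)^[2 * t + 1] z) atTop (nhds x1)) ∨
        (Tendsto (fun t => (gdMap η μ)^[2 * t] z) atTop (nhds x1) ∧
          Tendsto (fun t => (gdMap η μ)^[2 * t + 1] z) atTop (nhds x0))) ∧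
      MeasureTheory.volume {z : ℝ | z ∈ Set.Ioo (0 : ℝ) (Real.sqrt μ) ∧
        Tendsto (fun t => (gdMap η μ)^[t] z) atTop (nhds (Real.sqrt μ))} = 0 := by
  have hK : 0 < K := by linarith
  set s := Real.sqrt μ with hs
  have hs0 : 0 < s := Real.sqrt_pos.2 hμ
  have hs2 : s ^ 2 = μ := Real.sq_sqrt hμ.le
  have hη0 : η ≠ 0 := by rw [hη]; positivity
  have hconj : ∀ y, gdMap η μ (s * y) = s * gdMap K 1 y := by
    intro y
    unfold gdMap
    rw [hη, ← hs2]
    field_simp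
  have hiter : ∀ t y, (gdMap η μ)^[t] (s * y) = s * (gdMap K 1)^[t] y := by
    intro t
    induction t with
    | zero => intro y; rfl
    | succ n ih => intro y; rw [Function.iterate_succ_apply, hconj, ih, Function.iterate_succ_apply]
  obtain ⟨y0, y1, h0, h01, h11, hp, hsum⟩ := gd_norm_cycle K hK1 hK2
  have hp' : y1 * y0 = 1 / K := by rw [← hp]; ring
  have hsum' : y1 ^ 2 + y0 ^ 2 = 1 + 1 / K := by rw [← hsum]; ring
  have hfix : gdMap η μ s = s := by unfold gdMap; rw [hs2]; ring
  have hcase : ∀ z ∈ Set.Ioo (0 : ℝ) s, (∃ n, (gdMap η μ)^[n] z = s) ∨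
      gdCyc (gdMap η μ) (s * y0) (s * y1) z := by
    rintro z ⟨hz0, hz1⟩
    obtain ⟨y, rfl⟩ : ∃ y, z = s * y := ⟨z / s, by field_simp⟩
    rcases gd_norm_main K y0 y1 hK1 hK2 h0 h01 h11 hp hsum y (pos_of_mul_pos_right hz0 hs0.le)
      (by nlinarith) with ⟨n, hn⟩ | h
    · left; exact ⟨n, by rw [hiter, hn, mul_one]⟩
    · right
      unfold gdCyc
      simp only [hiter]
      rcases h with ⟨h1, h2⟩ | ⟨h1, h2⟩
      · exact Or.inl ⟨h1.const_mul s, h2.const_mul s⟩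
      · exact Or.inr ⟨h1.const_mul s, h2.const_mul s⟩
  have hform : ∀ y, 0 < y → K * (y ^ 2 * (Real.sqrt (1 / y ^ 2 - 3 / 4) + 1 / 2)) = 1 →
      η = 1 / ((s * y) ^ 2 * (Real.sqrt (μ / (s * y) ^ 2 - 3 / 4) + 1 / 2)) := by
    intro y hy h
    have e : μ / (s * y) ^ 2 = 1 / y ^ 2 := by rw [← hs2]; field_simp
    have hr := Real.sqrt_nonneg (1 / y ^ 2 - 3 / 4)
    rw [e, hη, ← hs2, mul_pow]
    generalize Real.sqrt (1 / y ^ 2 - 3 / 4) = r at *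
    rw [div_eq_div_iff (by positivity) (by positivity)]
    linear_combination s ^ 2 * h
  refine ⟨s * y0, s * y1, ⟨by positivity, by nlinarith, by nlinarith, ?_, ?_⟩, ?_, ?_, ?_, ?_⟩
  · rw [hconj, gd_norm_orbit K y0 y1 hK hp hsum]
  · rw [hconj, gd_norm_orbit K y1 y0 hK hp' hsum']
  · intro a b ha has hbs hab hba
    obtain ⟨a, rfl⟩ : ∃ y, a = s * y := ⟨a / s, by field_simp⟩
    obtain ⟨b, rfl⟩ : ∃ y, b = s * y := ⟨b / s, by field_simp⟩
    rw [hconj] at hab hba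
    have ha' : 0 < a := pos_of_mul_pos_right ha hs0.le
    have hab' : a < b := lt_of_mul_lt_mul_left (has.trans hbs) hs0.le
    obtain ⟨u1, u2⟩ := gd_norm_unique K a b hK ha' hab'
      (mul_left_cancel₀ hs0.ne' hab) (mul_left_cancel₀ hs0.ne' hba)
    obtain ⟨rfl, rfl⟩ := gd_norm_pair y0 y1 a b h0 (h01.trans h11) ha' hab'
      (u1.trans hp.symm) (u2.trans hsum.symm)
    exact ⟨rfl, rfl⟩
  · rintro x (rfl | rfl)
    · exact hform _ h0 (gd_norm_form K y0 y1 hK h0 hK2 hp hsum)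
    · exact hform _ (by linarith) (gd_norm_form K y1 y0 hK (by linarith) hK2 hp' hsum')
  · intro z hz
    rcases hcase z hz with ⟨n, hn⟩ | h
    · left
      rw [← tendsto_add_atTop_iff_nat n]
      simp only [Function.iterate_add_apply, hn, Function.iterate_fixed hfix]
      exact tendsto_const_nhds
    · exact Or.inr h
  · apply Set.Countable.measure_zero
    apply (gd_countable η μ s hη0).mono
    rintro z ⟨hz, ht⟩
    rcases hcase z hz with h | h
    · exact h
    · exfalso
      have hev : Tendsto (fun t => (gdMap η μ)^[2 * t] z) atTop (nhds s) :=
        ht.comp (tendsto_id.const_mul_atTop' (by norm_num))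
      rcases h with ⟨h1, -⟩ | ⟨h1, -⟩
      · have := tendsto_nhds_unique hev h1
        nlinarith
      · have := tendsto_nhds_unique hev h1
        nlinarith
end

section
/- Let μ > 0 and η = K/μ with 1 < K ≤ 1.121, and set F(x) = x + η·(μ − x²)·x. Then there exists a unique pair (x̄₀, x̄₁) with 0 < x̄₀ < √μ < x̄₁ such that F(x̄₀) = x̄₁ and F(x̄₁) = x̄₀; this pair satisfies x̄₀² + x̄₁² = μ + 1/η and x̄₀²·x̄₁² = 1/η², and each x ∈ {x̄₀, x̄₁} satisfies η = 1/(x²·(√(μ/x² − 3/4) + 1/2)). -/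
/-- The square root in the closed formula is `y / x - 1 / 2`. -/
lemma orbit_formula (η μ x y : ℝ) (hη : 0 < η) (hx : 0 < x) (hy : x ≤ 2 * y)
    (h1 : x ^ 2 - x * y + y ^ 2 = μ) (h2 : η * (x * y) = 1) :
    η = 1 / (x ^ 2 * (Real.sqrt (μ / x ^ 2 - 3 / 4) + 1 / 2)) := by
  have e : μ / x ^ 2 - 3 / 4 = (y / x - 1 / 2) ^ 2 := by
    rw [← h1]; field_simp; ring
  have hn : 0 ≤ y / x - 1 / 2 := by
    have : 1 / 2 ≤ y / x := by
      rw [le_div_iff₀ hx]; linarith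
    linarith
  rw [e, Real.sqrt_sq hn]
  have : x ^ 2 * (y / x - 1 / 2 + 1 / 2) = x * y := by
    field_simp; ring
  rw [this]
  exact eq_one_div_of_mul_eq_one_left h2

/-- A period-2 orbit with distinct positive points satisfies the Vieta relations. -/
lemma orbit_vieta (η μ r a b : ℝ) (hr : η * r = 1) (ha : 0 < a) (hab : a < b)
    (h1 : gdMap η μ a = b) (h2 : gdMap η μ b = a) :
    a ^ 2 + b ^ 2 = μ + r ∧ a * b = r := by
  unfold gdMap at h1 h2
  have e1 : η * (a ^ 2 - a * b + b ^ 2 - μ) = 0 := by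
    have : a + b ≠ 0 := by linarith
    apply mul_left_cancel₀ this
    linear_combination -h1 - h2
  have e2 : η * (a ^ 2 + a * b + b ^ 2 - μ) = 2 := by
    have : a - b ≠ 0 := by linarith
    apply mul_left_cancel₀ this
    linear_combination h2 - h1
  constructor
  · linear_combination r * (e1 + e2) / 2 - (a ^ 2 + b ^ 2 - μ) * hr
  · linear_combination r * (e2 - e1) / 2 - (a * b) * hr

/-- For `μ > 0` and `η = K/μ` with `1 < K ≤ 1.121`, the map
`F(x) = x + η (μ − x²) x` has a unique period-2 orbit `(x̄₀, x̄₁)` with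
`0 < x̄₀ < √μ < x̄₁`; the orbit satisfies the Vieta relations
`x̄₀² + x̄₁² = μ + 1/η` and `x̄₀² x̄₁² = 1/η²`, and each orbit point satisfies
`η = 1/(x² (√(μ/x² − 3/4) + 1/2))`. -/
theorem one_dim_period_two_orbit_exists_unique
    (μ K η : ℝ) (hμ : 0 < μ) (hK1 : 1 < K) (hK2 : K ≤ 1.121) (hη : η = K / μ) :
    ∃ x0 x1 : ℝ,
      (0 < x0 ∧ x0 < Real.sqrt μ ∧ Real.sqrt μ < x1 ∧
        gdMap η μ x0 = x1 ∧ gdMap η μ x1 = x0) ∧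
      (∀ a b : ℝ, 0 < a → a < Real.sqrt μ → Real.sqrt μ < b →
        gdMap η μ a = b → gdMap η μ b = a → a = x0 ∧ b = x1) ∧
      x0 ^ 2 + x1 ^ 2 = μ + 1 / η ∧
      x0 ^ 2 * x1 ^ 2 = 1 / η ^ 2 ∧
      (∀ x ∈ ({x0, x1} : Set ℝ),
        η = 1 / (x ^ 2 * (Real.sqrt (μ / x ^ 2 - 3 / 4) + 1 / 2))) := by
  have hK0 : 0 < K := by linarith
  have hη0 : 0 < η := by rw [hη]; positivity
  obtain ⟨r, hrdef⟩ : ∃ r, r = 1 / η := ⟨_, rfl⟩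
  have hr0 : 0 < r := by rw [hrdef]; positivity
  have hr : η * r = 1 := by rw [hrdef]; field_simp
  have hKr : K * r = μ := by rw [hrdef, hη]; field_simp
  have hrμ : r < μ := by nlinarith
  have hr3 : 2 * μ ≤ 3 * r := by norm_num at hK2; nlinarith
  obtain ⟨s, hs⟩ : ∃ s, s = Real.sqrt (μ + 3 * r) := ⟨_, rfl⟩
  obtain ⟨d, hd⟩ : ∃ d, d = Real.sqrt (μ - r) := ⟨_, rfl⟩
  have hs2 : s ^ 2 = μ + 3 * r := by rw [hs]; exact Real.sq_sqrt (by linarith)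
  have hd2 : d ^ 2 = μ - r := by rw [hd]; exact Real.sq_sqrt (by linarith)
  have hs0 : 0 < s := by rw [hs]; exact Real.sqrt_pos.2 (by linarith)
  have hd0 : 0 < d := by rw [hd]; exact Real.sqrt_pos.2 (by linarith)
  have hds : d < s := by nlinarith
  obtain ⟨a, ha⟩ : ∃ a, a = (s - d) / 2 := ⟨_, rfl⟩
  obtain ⟨b, hb⟩ : ∃ b, b = (s + d) / 2 := ⟨_, rfl⟩
  have ha0 : 0 < a := by linarith
  have hab : a < b := by linarith
  have hb0 : 0 < b := by linarith
  have hP : a * b = r := by rw [ha, hb]; linear_combination (hs2 - hd2) / 4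
  have hS : a ^ 2 + b ^ 2 = μ + r := by rw [ha, hb]; linear_combination (hs2 + hd2) / 2
  have hneg : (a ^ 2 - μ) * (b ^ 2 - μ) < 0 := by
    have : (a ^ 2 - μ) * (b ^ 2 - μ) = r * (r - μ) := by
      linear_combination (a * b + r) * hP - μ * hS
    rw [this]; nlinarith
  have hab2 : a ^ 2 < b ^ 2 := by nlinarith
  have haμ : a ^ 2 < μ := by by_contra h; nlinarith
  have hbμ : μ < b ^ 2 := by by_contra h; nlinarith
  have h2a : b ≤ 2 * a := by
    have : 0 ≤ (2 * a - b) * (2 * b - a) := by nlinarith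
    have h := nonneg_of_mul_nonneg_left this (by linarith)
    linarith
  have hPη : η * (a * b) = 1 := by rw [hP, hr]
  refine ⟨a, b, ⟨ha0, Real.lt_sqrt_of_sq_lt haμ, (Real.sqrt_lt' hb0).2 hbμ, ?_, ?_⟩,
    ?_, ?_, ?_, ?_⟩
  · unfold gdMap
    linear_combination (b - a) * hPη - η * a * (hS - hP)
  · unfold gdMap
    linear_combination (a - b) * hPη - η * b * (hS - hP)
  · intro p q hp0 hp hq h1 h2
    obtain ⟨v1, v2⟩ := orbit_vieta η μ r p q hr hp0 (hp.trans hq) h1 h2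
    have es : p + q = s := by
      have : (p + q) ^ 2 = s ^ 2 := by linear_combination v1 + 2 * v2 - hs2
      exact (pow_left_inj₀ (by linarith) hs0.le two_ne_zero).1 this
    have ed : q - p = d := by
      have : (q - p) ^ 2 = d ^ 2 := by linear_combination v1 - 2 * v2 - hd2
      exact (pow_left_inj₀ (by linarith) hd0.le two_ne_zero).1 this
    constructor <;> linarith
  · rw [hS, hrdef]
  · rw [← mul_pow, hP, hrdef]; field_simp
  · intro x hx
    rcases hx with rfl | hx
    · exact orbit_formula η μ x b hη0 ha0 (by linarith) (by linarith) hPη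
    · rw [Set.mem_singleton_iff] at hx
      subst hx
      exact orbit_formula η μ x a hη0 hb0 h2a (by linarith) (by linarith)
end

section
/- Let μ > 0 and η > 0 with η·μ > 1, and let a, b > 0 satisfy a + b = μ + 1/η and a·b = 1/η². Then (1 + η·(μ − 3a))·(1 + η·(μ − 3b)) = 9 − 2·(1 + η·μ)². Consequently, |(1 + η·(μ − 3a))·(1 + η·(μ − 3b))| < 1 if and only if η·μ < √5 − 1, and 0 ≤ (1 + η·(μ − 3a))·(1 + η·(μ − 3b)) < 1 if and only if η·μ ≤ √4.5 − 1. -/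
/-- If `a, b > 0` satisfy the Vieta relations `a + b = μ + 1/η` and
`a b = 1/η²` (with `μ > 0`, `η > 0`, `η μ > 1`), then the two-step contraction factor
satisfies `(1 + η(μ − 3a))(1 + η(μ − 3b)) = 9 − 2(1 + ημ)²`; its modulus is `< 1` iff
`η μ < √5 − 1`, and it lies in `[0, 1)` iff `η μ ≤ √4.5 − 1`. -/
theorem period_two_contraction_factor
    (μ η a b : ℝ) (hμ : 0 < μ) (hη : 0 < η) (hημ : 1 < η * μ)
    (ha : 0 < a) (hb : 0 < b)
    (hsum : a + b = μ + 1 / η) (hprod : a * b = 1 / η ^ 2) :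
    (1 + η * (μ - 3 * a)) * (1 + η * (μ - 3 * b)) = 9 - 2 * (1 + η * μ) ^ 2 ∧
    (|(1 + η * (μ - 3 * a)) * (1 + η * (μ - 3 * b))| < 1 ↔ η * μ < Real.sqrt 5 - 1) ∧
    ((0 ≤ (1 + η * (μ - 3 * a)) * (1 + η * (μ - 3 * b)) ∧
        (1 + η * (μ - 3 * a)) * (1 + η * (μ - 3 * b)) < 1) ↔
      η * μ ≤ Real.sqrt 4.5 - 1) := by
  have h1 : η * (a + b) = 1 + η * μ := by
    rw [hsum]; field_simp; ring
  have h2 : η ^ 2 * (a * b) = 1 := by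
    rw [hprod]; field_simp
  have key : (1 + η * (μ - 3 * a)) * (1 + η * (μ - 3 * b)) = 9 - 2 * (1 + η * μ) ^ 2 := by
    linear_combination (-3 * (1 + η * μ)) * h1 + 9 * h2
  refine ⟨key, ?_, ?_⟩
  · rw [key, abs_lt, lt_sub_iff_add_lt (a := η * μ), Real.lt_sqrt (by linarith)]
    generalize η * μ = t at hημ ⊢
    constructor
    · rintro ⟨h, _⟩
      nlinarith
    · intro h
      constructor <;> nlinarith
  · rw [key, le_sub_iff_add_le (a := η * μ), Real.le_sqrt' (by linarith)]
    generalize η * μ = t at hημ ⊢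
    constructor
    · rintro ⟨h, _⟩
      norm_num
      nlinarith
    · intro h
      norm_num at h
      constructor <;> nlinarith
end

section
/- Let μ > 0 and η = K/μ with 1 < K ≤ 1.121, and set F(x) = x + η·(μ − x²)·x. Then F maps the open interval (0, √(μ + 1/η)) into itself: for every x with 0 < x < √(μ + 1/η), one has 0 < F(x) < √(μ + 1/η). In particular, every gradient-descent trajectory of f(x) = (1/4)(x² − μ)² with step size η started at any x₀ ∈ (0, √μ) remains strictly positive for all time. -/
/-- For `μ > 0` and `η = K/μ` with `1 < K ≤ 1.121`, the gradient-descent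
map `F(x) = x + η (μ − x²) x` maps the open interval `(0, √(μ + 1/η))` into itself; in
particular every trajectory started in `(0, √μ)` stays strictly positive forever. -/
theorem gd_map_positive_invariant
    (μ K η : ℝ) (hμ : 0 < μ) (hK1 : 1 < K) (hK2 : K ≤ 1.121) (hη : η = K / μ) :
    (∀ x : ℝ, 0 < x → x < Real.sqrt (μ + 1 / η) →
      0 < gdMap η μ x ∧ gdMap η μ x < Real.sqrt (μ + 1 / η)) ∧
    (∀ x₀ ∈ Set.Ioo (0 : ℝ) (Real.sqrt μ), ∀ t : ℕ, 0 < (gdMap η μ)^[t] x₀) := by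
  have hη0 : 0 < η := by rw [hη]; positivity
  have hημ : η * μ = K := by rw [hη]; field_simp
  have hpos : 0 < μ + 1 / η := by positivity
  have hs0 : 0 < Real.sqrt (μ + 1 / η) := Real.sqrt_pos.mpr hpos
  have hs2 : η * Real.sqrt (μ + 1 / η) ^ 2 = K + 1 := by
    rw [Real.sq_sqrt hpos.le, mul_add, hημ]; field_simp
  have hle : Real.sqrt μ ≤ Real.sqrt (μ + 1 / η) := by
    apply Real.sqrt_le_sqrt
    have : 0 < 1 / η := by positivity
    linarith
  generalize Real.sqrt (μ + 1 / η) = s at *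
  have main : ∀ x : ℝ, 0 < x → x < s → 0 < gdMap η μ x ∧ gdMap η μ x < s := by
    intro x hx hxs
    have e : gdMap η μ x = η * (x * (s ^ 2 - x ^ 2)) := by
      unfold gdMap
      linear_combination x * hημ - x * hs2
    rw [e]
    constructor
    · have : 0 < s ^ 2 - x ^ 2 := by nlinarith
      positivity
    · have h1 : x * (s ^ 2 - x ^ 2) ≤ 0.4 * s ^ 3 := by
        have h2 : 0 ≤ (x - 0.58 * s) ^ 2 * (x + 1.16 * s) := by positivity
        have h3 : 0 ≤ s ^ 2 * x := by positivity
        have h4 : 0 ≤ s ^ 3 := by positivity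
        nlinarith
      calc η * (x * (s ^ 2 - x ^ 2)) ≤ η * (0.4 * s ^ 3) := by gcongr
        _ = 0.4 * (K + 1) * s := by linear_combination 0.4 * s * hs2
        _ < s := by nlinarith
  refine ⟨main, ?_⟩
  intro x₀ hx₀ t
  have h : 0 < (gdMap η μ)^[t] x₀ ∧ (gdMap η μ)^[t] x₀ < s := by
    induction t with
    | zero => exact ⟨hx₀.1, hx₀.2.trans_le hle⟩
    | succ n ih =>
      rw [Function.iterate_succ_apply']
      exact main _ ih.1 ih.2
  exact h.1
end

section
/- Let μ > 0 and η = K/μ with 1 < K ≤ √4.5 − 1, set F(x) = x + η·(μ − x²)·x, let x_s = √((μ + 1/η)/3), and let x̄₀ be the unique point of the period-2 orbit of F lying in [x_s, √μ). Then: (i) the two-step map F∘F is strictly increasing on [x_s, √μ]; (ii) for every x ∈ [x_s, x̄₀), F(F(x)) ∈ (x, x̄₀]; and (iii) for every x ∈ (x̄₀, √μ), F(F(x)) ∈ [x̄₀, x). -/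
/-- For `μ > 0` and `η = K/μ` with `1 < K ≤ √4.5 − 1`, let
`x_s = √((μ + 1/η)/3)` and let `x̄₀` be the (unique) point of the period-2 orbit of the
gradient-descent map `F` lying in `[x_s, √μ)`.  Then the two-step map `F ∘ F` is strictly
increasing on `[x_s, √μ]`; for `x ∈ [x_s, x̄₀)` one has `F(F(x)) ∈ (x, x̄₀]`; and for
`x ∈ (x̄₀, √μ)` one has `F(F(x)) ∈ [x̄₀, x)`. -/
theorem gd_two_step_monotone_attraction
    (μ K η : ℝ) (hμ : 0 < μ) (hK1 : 1 < K) (hK2 : K ≤ Real.sqrt 4.5 - 1)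
    (hη : η = K / μ) (xs x0 : ℝ)
    (hxs : xs = Real.sqrt ((μ + 1 / η) / 3))
    (hx0mem : x0 ∈ Set.Ico xs (Real.sqrt μ))
    (hx0per : gdMap η μ (gdMap η μ x0) = x0)
    (hx0ne : gdMap η μ x0 ≠ x0) :
    StrictMonoOn (fun x => gdMap η μ (gdMap η μ x)) (Set.Icc xs (Real.sqrt μ)) ∧
    (∀ x ∈ Set.Ico xs x0, gdMap η μ (gdMap η μ x) ∈ Set.Ioc x x0) ∧
    (∀ x ∈ Set.Ioo x0 (Real.sqrt μ), gdMap η μ (gdMap η μ x) ∈ Set.Ico x0 x) := by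
  obtain ⟨hx0a, hx0b⟩ := hx0mem
  have hηpos : 0 < η := by rw [hη]; exact div_pos (by linarith) hμ
  have hημ : η * μ = K := by rw [hη]; field_simp
  have hq : 0 < (μ + 1 / η) / 3 := by positivity
  have hxspos : 0 < xs := by rw [hxs]; exact Real.sqrt_pos.mpr hq
  have hxs2 : 3 * (η * xs ^ 2) = 1 + K := by
    rw [hxs, Real.sq_sqrt hq.le, ← hημ]; field_simp; ring
  have hsq : Real.sqrt μ ^ 2 = μ := Real.sq_sqrt hμ.le
  have hFs : gdMap η μ (Real.sqrt μ) = Real.sqrt μ := by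
    unfold gdMap; rw [hsq]; ring
  have hanti : ∀ x y, xs ≤ x → x < y → gdMap η μ y < gdMap η μ x := by
    intro x y hx hxy
    have h1 : gdMap η μ x - gdMap η μ y
        = (y - x) * (η * (x ^ 2 + x * y + y ^ 2) - (1 + K)) := by
      unfold gdMap; rw [← hημ]; ring
    have h2 : 3 * xs ^ 2 < x ^ 2 + x * y + y ^ 2 := by nlinarith
    have h3 := mul_lt_mul_of_pos_left h2 hηpos
    have h4 : 0 < (y - x) * (η * (x ^ 2 + x * y + y ^ 2) - (1 + K)) :=
      mul_pos (by linarith) (by linarith)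
    linarith
  have hmono : StrictMonoOn (fun x => gdMap η μ (gdMap η μ x))
      (Set.Icc xs (Real.sqrt μ)) := by
    intro x hx y hy hxy
    have h1 : Real.sqrt μ ≤ gdMap η μ y := by
      rcases eq_or_lt_of_le hy.2 with h | h
      · rw [h, hFs]
      · have := hanti y _ hy.1 h
        rw [hFs] at this; exact this.le
    exact hanti _ _ (by linarith) (hanti x y hx.1 hxy)
  have hkey : ∀ x, gdMap η μ (gdMap η μ x) - x =
      x * (((1 + K - η * x ^ 2) ^ 2 - 1) *
        ((1 + K - η * x ^ 2) ^ 2 + 1 - (1 + K) * (1 + K - η * x ^ 2))) := by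
    intro x; unfold gdMap; rw [← hημ]; ring
  have ha : ∀ x, 0 < x → x < Real.sqrt μ → 1 < 1 + K - η * x ^ 2 := by
    intro x hx hxl
    have h2 : x ^ 2 < μ := by rw [← hsq]; gcongr
    have h3 := mul_lt_mul_of_pos_left h2 hηpos
    linarith
  have hx0pos : 0 < x0 := by linarith
  have ha0 := ha x0 hx0pos hx0b
  have hk0 := hkey x0
  rw [hx0per, sub_self] at hk0
  set a0 := 1 + K - η * x0 ^ 2 with ha0def
  have hr : a0 ^ 2 + 1 - (1 + K) * a0 = 0 := by
    rcases mul_eq_zero.mp hk0.symm with h | h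
    · linarith
    · rcases mul_eq_zero.mp h with h | h
      · nlinarith
      · exact h
  have hfac : ∀ a, a0 * (a ^ 2 + 1 - (1 + K) * a) = (a - a0) * (a * a0 - 1) := by
    intro a; linear_combination a * hr
  refine ⟨hmono, ?_, ?_⟩
  · rintro x ⟨hx1, hx2⟩
    have hxp : 0 < x := by linarith
    have h1 := hmono ⟨hx1, by linarith⟩ ⟨hx0a, hx0b.le⟩ hx2
    simp only [hx0per] at h1
    refine ⟨?_, h1.le⟩
    have hax := ha x hxp (by linarith)
    have hk := hkey x
    have hlt : a0 < 1 + K - η * x ^ 2 := by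
      have h2 : x ^ 2 < x0 ^ 2 := by gcongr
      have h3 := mul_lt_mul_of_pos_left h2 hηpos
      linarith
    have hf := hfac (1 + K - η * x ^ 2)
    set a := 1 + K - η * x ^ 2
    have h5 : 0 < (a - a0) * (a * a0 - 1) :=
      mul_pos (sub_pos.mpr hlt) (sub_pos.mpr (one_lt_mul_of_lt_of_le hax ha0.le))
    rw [← hf] at h5
    have h6 := pos_of_mul_pos_right h5 (by linarith)
    have h7 : 0 < a ^ 2 - 1 := sub_pos.mpr (one_lt_pow₀ hax two_ne_zero)
    have h8 := mul_pos hxp (mul_pos h7 h6)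
    linarith
  · rintro x ⟨hx1, hx2⟩
    have hxp : 0 < x := by linarith
    have h1 := hmono ⟨hx0a, hx0b.le⟩ ⟨by linarith, hx2.le⟩ hx1
    simp only [hx0per] at h1
    refine ⟨h1.le, ?_⟩
    have hax := ha x hxp (by linarith)
    have hk := hkey x
    have hlt : 1 + K - η * x ^ 2 < a0 := by
      have h2 : x0 ^ 2 < x ^ 2 := by gcongr
      have h3 := mul_lt_mul_of_pos_left h2 hηpos
      linarith
    have hf := hfac (1 + K - η * x ^ 2)
    set a := 1 + K - η * x ^ 2
    have h5 : 0 < (a0 - a) * (a * a0 - 1) :=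
      mul_pos (sub_pos.mpr hlt) (sub_pos.mpr (one_lt_mul_of_lt_of_le hax ha0.le))
    have h5' : 0 < a0 * -(a ^ 2 + 1 - (1 + K) * a) := by
      rw [mul_neg, hf, ← neg_mul, neg_sub]; exact h5
    have h6 := pos_of_mul_pos_right h5' (by linarith)
    have h7 : 0 < a ^ 2 - 1 := sub_pos.mpr (one_lt_pow₀ hax two_ne_zero)
    have h8 := mul_pos hxp (mul_pos h7 h6)
    linarith
end

section
/- Let μ > 0 and η = K/μ with 1 < K < 1.5. Consider the gradient-descent process on f(x, y) = (1/2)·(x·y − μ)²: x_{t+1} = x_t − η·(x_t·y_t − μ)·y_t and y_{t+1} = y_t − η·(x_t·y_t − μ)·x_t. Assume x_t > 0 and y_t > 0 for all t ≥ 0, and let t₀ < t₁ < t₂ < ⋯ enumerate the set P = {t : x_t·y_t > μ}. Then the sequence (|x_{t_k} − y_{t_k}|)_k is non-increasing, strictly decreasing whenever its terms are nonzero, and if P is infinite it converges to 0. -/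
open Filter

lemma bal_step (K : ℝ) (hK1 : 1 < K) (hK2 : K < 3/2) :
    ∃ c > 0, ∀ e D e1 : ℝ, 0 < e → K * e < 1 → 0 ≤ D →
      e1 = (1 + e) * (1 - K * e) ^ 2 - 1 - K * e * D → -1 < e1 →
      e1 < 0 ∧ |(1 + K * e) * (1 + K * e1)| ≤ 1 - c * (K * e) := by
  refine ⟨min (2 * (K - 1)) (3 - 2 * K), lt_min (by linarith) (by linarith), ?_⟩
  intro e D e1 he hKe hD he1 hlow
  set c := min (2 * (K - 1)) (3 - 2 * K) with hc
  have hc1 : c ≤ 2 * (K - 1) := min_le_left _ _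
  have hc2 : c ≤ 3 - 2 * K := min_le_right _ _
  obtain ⟨u, hu⟩ : ∃ u, u = K * e := ⟨_, rfl⟩
  have hu0 : 0 < u := by rw [hu]; positivity
  rw [← hu] at hKe he1 ⊢
  have hKe1 : K * e1 ≤ u * (1 - 2 * K) + u ^ 2 * (K - 2) + u ^ 3 := by
    have h1 : K * e1 = u * (1 - 2 * K) + u ^ 2 * (K - 2) + u ^ 3 - K * (u * D) := by
      rw [he1]; linear_combination ((1 - u) ^ 2) * (-hu)
    have : 0 ≤ K * (u * D) := by positivity
    linarith
  have hq : u * (1 - 2 * K) + u ^ 2 * (K - 2) + u ^ 3 < 0 := by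
    have : (1 - 2 * K) + u * (K - 2) + u ^ 2 < 0 := by nlinarith
    nlinarith
  have hneg : e1 < 0 := by
    by_contra h
    push Not at h
    have : 0 ≤ K * e1 := by positivity
    linarith
  refine ⟨hneg, abs_le.mpr ⟨?_, ?_⟩⟩
  · have h1 : -(K - 1) ≤ 1 + K * e1 := by nlinarith
    have h2 : (1 + u) * (-(K - 1)) ≤ (1 + u) * (1 + K * e1) :=
      mul_le_mul_of_nonneg_left h1 (by linarith)
    have h3 : c * u ≤ (3 - 2 * K) * u := mul_le_mul_of_nonneg_right hc2 hu0.le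
    nlinarith
  · have h2 : (1 + u) * (1 + K * e1) ≤
        (1 + u) * (1 + (u * (1 - 2 * K) + u ^ 2 * (K - 2) + u ^ 3)) :=
      mul_le_mul_of_nonneg_left (by linarith) (by linarith)
    have h3 : c * u ≤ (2 * (K - 1)) * u := mul_le_mul_of_nonneg_right hc1 hu0.le
    have h4 : - u * (K + 1) + u ^ 2 * (K - 1) + u ^ 3 ≤ 0 := by
      have : - (K + 1) + u * (K - 1) + u ^ 2 ≤ 0 := by nlinarith
      nlinarith
    have h5 := mul_le_mul_of_nonneg_left h4 hu0.le
    nlinarith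

set_option maxHeartbeats 1600000 in
lemma bal_grow (K B : ℝ) (hK1 : 1 < K) (hK2 : K < 3/2) (hB : 0 ≤ B) :
    ∃ ε > 0, ∀ e D e1 D1 e2 : ℝ, 0 < e → e < ε → 0 ≤ D → D ≤ B → 0 ≤ D1 →
      e1 = (1 + e) * (1 - K * e) ^ 2 - 1 - K * e * D →
      e2 = (1 + e1) * (1 - K * e1) ^ 2 - 1 - K * e1 * D1 → e ≤ e2 := by
  have hM : 0 < K * (2 * K + K * B) := by positivity
  refine ⟨(K - 1) / (K * (2 * K + K * B)), div_pos (by linarith) hM, ?_⟩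
  intro e D e1 D1 e2 he hlt hD hDB hD1 he1 he2
  rw [lt_div_iff₀ hM] at hlt
  have hKB : 0 ≤ K * B := by positivity
  have hKe : K * e < K - 1 := by
    have : 0 ≤ (K * e) * (2 * K + K * B - 1) := by
      apply mul_nonneg (by positivity); linarith
    nlinarith
  have hKe0 : 0 < K * e := by positivity
  obtain ⟨a, ha⟩ : ∃ a, a = -e1 := ⟨_, rfl⟩
  have ha' : a = e * ((2 * K - 1) + K * D + e * (2 * K - K ^ 2) - (K * e) ^ 2) := by
    rw [ha, he1]; ring
  have hKK : 0 < 2 * K - K ^ 2 := by nlinarith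
  have hKK1 : 2 * K - K ^ 2 ≤ 1 := by nlinarith [sq_nonneg (K - 1)]
  have he_lt : e < 1 := by nlinarith
  have hsq : (K * e) ^ 2 ≤ K - 1 := by nlinarith
  have hKD : K * D ≤ K * B := mul_le_mul_of_nonneg_left hDB (by linarith)
  have hKD0 : 0 ≤ K * D := by positivity
  have hea : e ≤ a := by
    have h0 : 0 ≤ e * (2 * K - K ^ 2) := by positivity
    have : 1 ≤ (2 * K - 1) + K * D + e * (2 * K - K ^ 2) - (K * e) ^ 2 := by linarith
    rw [ha']; nlinarith
  have hae : a ≤ e * (2 * K + K * B) := by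
    rw [ha']
    apply mul_le_mul_of_nonneg_left _ he.le
    have : e * (2 * K - K ^ 2) ≤ 1 := by nlinarith
    nlinarith [sq_nonneg (K * e)]
  have ha0 : 0 < a := by linarith
  have hKa : K * a ≤ K - 1 := by nlinarith
  have ha1 : a < 1 := by nlinarith
  have he2' : e2 = a * ((2 * K - 1) - a * (2 * K - K ^ 2) - (K * a) ^ 2) + K * a * D1 := by
    have : e1 = -a := by linarith
    rw [he2, this]; ring
  have h1 : 1 ≤ (2 * K - 1) - a * (2 * K - K ^ 2) - (K * a) ^ 2 := by
    have h2 : K * a * (K * a) ≤ K * a * (K - 1) :=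
      mul_le_mul_of_nonneg_left hKa (by positivity)
    nlinarith
  have h2 : 0 ≤ K * a * D1 := by positivity
  rw [he2']; nlinarith

lemma bal_abs (K μ : ℝ) (hμ : 0 < μ) (hK1 : 1 < K) (hK2 : K < 3/2) (e d : ℕ → ℝ)
    (he : ∀ t, e (t + 1) = (1 + e t) * (1 - K * e t) ^ 2 - 1 - K * e t * (d t ^ 2 / μ))
    (hd : ∀ t, d (t + 1) = d t * (1 + K * e t))
    (hlow : ∀ t, -1 < e t) (hup : ∀ t, K * e t < 1) :
    ∃ V : ℕ → ℝ, Antitone V ∧ (∀ t, 0 < e t → V t = |d t|) ∧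
      (∀ t, 0 < e t → d t ≠ 0 → V (t + 1) < V t) ∧
      ((∀ N, ∃ t ≥ N, 0 < e t) → Tendsto V atTop (nhds 0)) := by
  obtain ⟨c, hc, hstep⟩ := bal_step K hK1 hK2
  have hD : ∀ t, 0 ≤ d t ^ 2 / μ := fun t => by positivity
  let V : ℕ → ℝ := fun t => if 0 < e t then |d t| else |d (t + 1)|
  have hVP : ∀ t, 0 < e t → V t = |d t| := fun t h => if_pos h
  have hVN : ∀ t, ¬ 0 < e t → V t = |d (t + 1)| := fun t h => if_neg h
  have hV0 : ∀ t, 0 ≤ V t := by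
    intro t
    by_cases h : 0 < e t
    · rw [hVP t h]; positivity
    · rw [hVN t h]; positivity
  have hdec : ∀ t, 0 < e t → V (t + 1) ≤ (1 - c * (K * e t)) * V t := by
    intro t h
    obtain ⟨h1, h2⟩ := hstep (e t) _ _ h (hup t) (hD t) (he t) (hlow _)
    rw [hVP t h, hVN (t + 1) (by linarith), hd (t + 1), hd t]
    calc |d t * (1 + K * e t) * (1 + K * e (t + 1))|
        = |(1 + K * e t) * (1 + K * e (t + 1))| * |d t| := by rw [← abs_mul]; ring_nf
      _ ≤ _ := mul_le_mul_of_nonneg_right h2 (abs_nonneg _)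
  have hanti : Antitone V := by
    apply antitone_nat_of_succ_le
    intro t
    by_cases h : 0 < e t
    · have h1 := hdec t h
      have : 0 ≤ c * (K * e t) * V t := by have := hV0 t; positivity
      linarith
    · by_cases h' : 0 < e (t + 1)
      · rw [hVN t h, hVP _ h']
      · rw [hVN t h, hVN _ h', hd (t + 1), abs_mul]
        have : |1 + K * e (t + 1)| ≤ 1 := by
          have := hlow (t + 1)
          rw [abs_le]; constructor <;> nlinarith
        exact mul_le_of_le_one_right (abs_nonneg _) this
  refine ⟨V, hanti, hVP, ?_, ?_⟩
  · intro t h hd0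
    have h1 := hdec t h
    have h2 : 0 < V t := by rw [hVP t h]; positivity
    have : 0 < c * (K * e t) * V t := by positivity
    linarith
  · intro hinf
    have hlim := tendsto_atTop_ciInf hanti ⟨0, by rintro _ ⟨t, rfl⟩; exact hV0 t⟩
    obtain ⟨L, hL⟩ : ∃ L, L = ⨅ i, V i := ⟨_, rfl⟩
    rw [← hL] at hlim
    have hLle : ∀ t, L ≤ V t := fun t => hanti.le_of_tendsto hlim t
    have hL0 : 0 ≤ L := ge_of_tendsto' hlim hV0
    rcases hL0.eq_or_lt with h0 | hLpos
    · rw [h0]; exact hlim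
    exfalso
    have hsmall : ∀ δ > 0, ∃ N, ∀ t ≥ N, 0 < e t → e t < δ := by
      intro δ hδ
      have hdiff : Tendsto (fun t => V t - V (t + 1)) atTop (nhds 0) := by
        have := hlim.sub (hlim.comp (tendsto_add_atTop_nat 1))
        simpa using this
      have hpos : 0 < c * (K * δ) * L := by positivity
      obtain ⟨N, hN⟩ := eventually_atTop.mp (hdiff.eventually (gt_mem_nhds hpos))
      refine ⟨N, fun t ht h => ?_⟩
      by_contra hcon
      push Not at hcon
      have h1 := hdec t h
      have h2 := hN t ht
      have h3 : c * (K * δ) * L ≤ c * (K * e t) * V t := by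
        have := hLle t
        gcongr
      linarith
    obtain ⟨ε, hε, hgrow⟩ := bal_grow K (V 0 ^ 2 / μ) hK1 hK2 (by positivity)
    obtain ⟨N, hN⟩ := hsmall ε hε
    obtain ⟨t, ht, hte⟩ := hinf N
    have hall : ∀ j, e t ≤ e (t + 2 * j) := by
      intro j
      induction j with
      | zero => simp
      | succ j ih =>
        have hp : 0 < e (t + 2 * j) := by linarith
        have hb : d (t + 2 * j) ^ 2 / μ ≤ V 0 ^ 2 / μ := by
          have h1 : |d (t + 2 * j)| ≤ V 0 := by
            rw [← hVP _ hp]; exact hanti (Nat.zero_le _)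
          have h2 : d (t + 2 * j) ^ 2 ≤ V 0 ^ 2 := by
            rw [← sq_abs]; gcongr
          gcongr
        have := hgrow _ _ _ _ _ hp (hN _ (by omega) hp) (hD _) hb (hD _) (he _) (he _)
        exact ih.trans this
    obtain ⟨N', hN'⟩ := hsmall (e t) hte
    have h1 := hall N'
    have h2 := hN' (t + 2 * N') (by omega) (by linarith)
    linarith

/-- (Balancing effect.) For gradient descent on
`f(x, y) = (1/2)(xy − μ)²` with step size `η = K/μ`, `1 < K < 1.5`, assuming both
coordinates stay positive, along the subsequence of times `t` with `x_t y_t > μ` the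
imbalance `|x_t − y_t|` is non-increasing, strictly decreasing whenever nonzero, and
tends to `0` if there are infinitely many such times. -/
theorem two_dim_balancing
    (μ K η : ℝ) (x y : ℕ → ℝ)
    (hμ : 0 < μ) (hK1 : 1 < K) (hK2 : K < 1.5) (hη : η = K / μ)
    (hx : ∀ t, x (t + 1) = x t - η * (x t * y t - μ) * y t)
    (hy : ∀ t, y (t + 1) = y t - η * (x t * y t - μ) * x t)
    (hpos : ∀ t, 0 < x t ∧ 0 < y t) :
    (∀ s t : ℕ, s < t → μ < x s * y s → μ < x t * y t →
      |x t - y t| ≤ |x s - y s|) ∧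
    (∀ s t : ℕ, s < t → μ < x s * y s → μ < x t * y t → x s ≠ y s →
      |x t - y t| < |x s - y s|) ∧
    ({t : ℕ | μ < x t * y t}.Infinite →
      Tendsto (fun k => |x (Nat.nth (fun t => μ < x t * y t) k)
          - y (Nat.nth (fun t => μ < x t * y t) k)|) atTop (nhds 0)) := by
  have hK2' : K < 3 / 2 := by norm_num at hK2 ⊢; linarith
  have hw : ∀ t, η * (x t * y t - μ) = K * (x t * y t / μ - 1) := by
    intro t; rw [hη]; field_simp
  have hP : ∀ t, μ < x t * y t ↔ 0 < x t * y t / μ - 1 := by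
    intro t; rw [sub_pos, one_lt_div hμ]
  obtain ⟨V, hanti, hVP, hstrict, hlim⟩ := bal_abs K μ hμ hK1 hK2'
    (fun t => x t * y t / μ - 1) (fun t => x t - y t)
    (by
      intro t
      simp only [hx t, hy t, hw t]
      field_simp
      ring)
    (by
      intro t
      simp only [hx t, hy t, hw t]
      ring)
    (by
      intro t
      have : 0 < x t * y t / μ := div_pos (mul_pos (hpos t).1 (hpos t).2) hμ
      linarith)
    (by
      intro t
      have h1 := hpos (t + 1)
      have h2 := hpos t
      rw [hx t, hy t, hw t] at h1
      by_contra hcon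
      push Not at hcon
      nlinarith [h1.1, h1.2, h2.1, h2.2])

  refine ⟨?_, ?_, ?_⟩
  · intro s t hst hs ht
    rw [← hVP t ((hP t).1 ht), ← hVP s ((hP s).1 hs)]
    exact hanti hst.le
  · intro s t hst hs ht hne
    rw [← hVP t ((hP t).1 ht), ← hVP s ((hP s).1 hs)]
    exact (hanti hst).trans_lt (hstrict s ((hP s).1 hs) (sub_ne_zero.2 hne))
  · intro hinf
    have h1 := hlim (by
      intro N
      obtain ⟨t, ht, hN⟩ := hinf.exists_gt N
      exact ⟨t, hN.le, (hP t).1 ht⟩)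
    have h2 := h1.comp (Nat.nth_strictMono hinf).tendsto_atTop
    refine h2.congr ?_
    intro k
    exact hVP _ ((hP _).1 (Nat.nth_mem_of_infinite hinf k))
end
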